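/- arXiv:1810.03666 — 4 statements merged into one kernel-verified Lean document; each statement's English description precedes it below -/
import Mathlib

section
/- Let X be a finite set with |X| ≥ 5. There is no function φ : RP(X)² → RP(X) that is idempotent (φ(T, T) = T for all T), commutative (φ(T₁, T₂) = φ(T₂, T₁)), associative (φ(φ(T₁, T₂), T₃) = φ(T₁, φ(T₂, T₃))), neutral (φ(σ·T₁, σ·T₂) = σ·φ(T₁, T₂) for every bijection σ : X → X), and Pareto on rooted triples. -/
open Set

variable {α : Type*}

/-- `T` is the hierarchy of clusters of a rooted phylogenetic tree on the taxon set `X`: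
a family of nonempty subsets of `X` containing `X` itself and all singletons, in which
any two members intersect trivially (`A ∩ B ∈ {∅, A, B}`). -/
def IsHierarchy (X : Set α) (T : Set (Set α)) : Prop :=
  (∀ C ∈ T, C ⊆ X ∧ C.Nonempty) ∧ X ∈ T ∧ (∀ x ∈ X, ({x} : Set α) ∈ T) ∧
    ∀ A ∈ T, ∀ B ∈ T, A ∩ B = ∅ ∨ A ∩ B = A ∨ A ∩ B = B

/-- `RP X`: rooted phylogenetic trees on `X`, modeled as their hierarchies of clusters. -/
def RP (X : Set α) : Set (Set (Set α)) := {T | IsHierarchy X T}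

/-- Restriction `T|_Y` of a tree to a subset `Y` of the taxa:
`T|_Y = {C ∩ Y : C ∈ T, C ∩ Y ≠ ∅}`. -/
def restrictTree (Y : Set α) (T : Set (Set α)) : Set (Set α) :=
  {D | ∃ C ∈ T, D = C ∩ Y ∧ (C ∩ Y).Nonempty}

/-- A tree is binary iff it is maximal in `(RP X, ⊆)`. -/
def IsBinary (X : Set α) (T : Set (Set α)) : Prop :=
  T ∈ RP X ∧ ∀ T' ∈ RP X, T ⊆ T' → T' = T

/-- `RBP X`: rooted binary phylogenetic trees on `X`. -/
def RBP (X : Set α) : Set (Set (Set α)) := {T | IsBinary X T}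

/-- Relabeling a tree along a map `σ`: `σ·T = {σ(C) : C ∈ T}`. -/
def mapTree (σ : α → α) (T : Set (Set α)) : Set (Set α) := (Set.image σ) '' T

/-- All requirements on the operation, bundled. -/
def Good (X : Set α) (φ : Set (Set α) → Set (Set α) → Set (Set α)) : Prop :=
  (∀ T₁ ∈ RP X, ∀ T₂ ∈ RP X, φ T₁ T₂ ∈ RP X) ∧
  (∀ T ∈ RP X, φ T T = T) ∧
  (∀ T₁ ∈ RP X, ∀ T₂ ∈ RP X, φ T₁ T₂ = φ T₂ T₁) ∧
  (∀ T₁ ∈ RP X, ∀ T₂ ∈ RP X, ∀ T₃ ∈ RP X, φ (φ T₁ T₂) T₃ = φ T₁ (φ T₂ T₃)) ∧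
  (∀ σ : α → α, Set.BijOn σ X X → ∀ T₁ ∈ RP X, ∀ T₂ ∈ RP X,
    φ (mapTree σ T₁) (mapTree σ T₂) = mapTree σ (φ T₁ T₂)) ∧
  (∀ W : Set α, W ⊆ X → W.ncard = 3 → ∀ T' ∈ RP W, ∀ T₁ ∈ RP X, ∀ T₂ ∈ RP X,
    T' ⊆ restrictTree W T₁ → T' ⊆ restrictTree W T₂ → T' ⊆ restrictTree W (φ T₁ T₂))

def disp (T : Set (Set α)) (x y z : α) : Prop := ∃ C ∈ T, x ∈ C ∧ y ∈ C ∧ z ∉ C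

theorem cherry_mem (x y z : α) (hxz : x ≠ z) (hyz : y ≠ z) :
    ({{x, y, z}, {x}, {y}, {z}, {x, y}} : Set (Set α)) ∈ RP ({x, y, z} : Set α) := by
  refine ⟨?_, by simp, ?_, ?_⟩
  · intro C hC
    simp only [mem_insert_iff, mem_singleton_iff] at hC
    rcases hC with rfl | rfl | rfl | rfl | rfl <;>
      simp [Set.insert_subset_iff]
  · intro w hw
    simp only [mem_insert_iff, mem_singleton_iff] at hw
    rcases hw with rfl | rfl | rfl <;> simp
  · intro A hA B hB
    simp only [mem_insert_iff, mem_singleton_iff] at hA hB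
    by_cases hxy : x = y
    · subst hxy
      rcases hA with rfl | rfl | rfl | rfl | rfl <;> rcases hB with rfl | rfl | rfl | rfl | rfl <;>
      simp only [Set.ext_iff, mem_inter_iff, mem_insert_iff, mem_singleton_iff, mem_empty_iff_false] <;>
      grind
    · rcases hA with rfl | rfl | rfl | rfl | rfl <;> rcases hB with rfl | rfl | rfl | rfl | rfl <;>
      simp only [Set.ext_iff, mem_inter_iff, mem_insert_iff, mem_singleton_iff, mem_empty_iff_false] <;>
      grind

theorem cherry_sub {X : Set α} {T : Set (Set α)} (hT : T ∈ RP X) {x y z : α} (hx : x ∈ X)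
    (hy : y ∈ X) (hz : z ∈ X) (hxy : x ≠ y) (hxz : x ≠ z) (hyz : y ≠ z) (h : disp T x y z) :
    ({{x, y, z}, {x}, {y}, {z}, {x, y}} : Set (Set α)) ⊆ restrictTree {x, y, z} T := by
  obtain ⟨h1, h2, h3, h4⟩ := hT
  obtain ⟨C, hC, hxC, hyC, hzC⟩ := h
  intro D hD
  simp only [mem_insert_iff, mem_singleton_iff] at hD
  rcases hD with rfl | rfl | rfl | rfl | rfl
  · have : X ∩ {x, y, z} = {x, y, z} := by
      apply Set.inter_eq_right.2; intro w; simp; rintro (rfl | rfl | rfl) <;> assumption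
    exact ⟨X, h2, this.symm, by rw [this]; simp⟩
  · exact ⟨{x}, h3 x hx, by ext w; simp, ⟨x, by simp⟩⟩
  · exact ⟨{y}, h3 y hy, by ext w; simp, ⟨y, by simp⟩⟩
  · exact ⟨{z}, h3 z hz, by ext w; simp, ⟨z, by simp⟩⟩
  · exact ⟨C, hC, by ext w; simp; grind, ⟨x, by simp [hxC]⟩⟩

theorem Good.pareto {X : Set α} {φ} (h : Good X φ) {T₁ T₂ : Set (Set α)} (hT₁ : T₁ ∈ RP X)
    (hT₂ : T₂ ∈ RP X) {x y z : α} (hx : x ∈ X)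
    (hy : y ∈ X) (hz : z ∈ X) (hxy : x ≠ y) (hxz : x ≠ z) (hyz : y ≠ z) (h₁ : disp T₁ x y z)
    (h₂ : _root_.disp T₂ x y z) : _root_.disp (φ T₁ T₂) x y z := by
  have := h.2.2.2.2.2 {x, y, z}
    (by intro w; simp; rintro (rfl | rfl | rfl) <;> assumption)
    (by rw [Set.ncard_eq_three]; exact ⟨x, y, z, hxy, hxz, hyz, rfl⟩)
    _ (cherry_mem x y z hxz hyz) T₁ hT₁ T₂ hT₂
    (cherry_sub hT₁ hx hy hz hxy hxz hyz h₁) (cherry_sub hT₂ hx hy hz hxy hxz hyz h₂)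
  obtain ⟨C, hC, hCe, -⟩ := this (show ({x, y} : Set α) ∈ _ by simp)
  refine ⟨C, hC, ?_, ?_, ?_⟩
  · have : x ∈ C ∩ {x, y, z} := hCe ▸ (by simp)
    exact this.1
  · have : y ∈ C ∩ {x, y, z} := hCe ▸ (by simp)
    exact this.1
  · intro hz
    have : z ∈ ({x, y} : Set α) := hCe.symm ▸ (⟨hz, by simp⟩ : z ∈ C ∩ {x, y, z})
    simp at this; grind

/-! ### Reduction of the number of taxa by one -/

def liftTree (X : Set α) (e : α) (T : Set (Set α)) : Set (Set α) := T ∪ {X, {e}}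

theorem lift_mem {X : Set α} {e : α} (he : e ∈ X) {T : Set (Set α)} (hT : T ∈ RP (X \ {e})) :
    liftTree X e T ∈ RP X := by
  obtain ⟨h1, h2, h3, h4⟩ := hT
  have hs : ∀ A ∈ T, A ∩ X = A ∧ A ∩ {e} = ∅ := by
    intro A hA
    have := (h1 A hA).1
    constructor
    · exact Set.inter_eq_left.2 (this.trans sdiff_subset)
    · ext w; simp; rintro hw rfl; exact (this hw).2 rfl
  refine ⟨?_, by simp [liftTree], ?_, ?_⟩
  · rintro C (hC | rfl | rfl)
    · exact ⟨(h1 C hC).1.trans sdiff_subset, (h1 C hC).2⟩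
    · exact ⟨le_rfl, e, he⟩
    · exact ⟨by simpa using he, by simp⟩
  · intro x hx
    by_cases hxe : x = e
    · subst hxe; simp [liftTree]
    · exact Or.inl (h3 x ⟨hx, hxe⟩)
  · have hXe : X ∩ {e} = {e} := by simpa using he
    rintro A (hA | rfl | rfl) B (hB | rfl | rfl)
    · exact h4 A hA B hB
    · exact Or.inr (Or.inl (hs A hA).1)
    · exact Or.inl (hs A hA).2
    · exact Or.inr (Or.inr (by rw [inter_comm]; exact (hs B hB).1))
    · simp
    · exact Or.inr (Or.inr hXe)
    · exact Or.inl (by rw [inter_comm]; exact (hs B hB).2)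
    · exact Or.inr (Or.inl (by rw [inter_comm]; exact hXe))
    · simp

theorem restrict_mem {X Y : Set α} (hY : Y ⊆ X) (hne : Y.Nonempty) {T : Set (Set α)}
    (hT : T ∈ RP X) : restrictTree Y T ∈ RP Y := by
  obtain ⟨h1, h2, h3, h4⟩ := hT
  have hXY : X ∩ Y = Y := Set.inter_eq_right.2 hY
  refine ⟨?_, ⟨X, h2, hXY.symm, by rwa [hXY]⟩, ?_, ?_⟩
  · rintro D ⟨C, hC, rfl, hn⟩
    exact ⟨inter_subset_right, hn⟩
  · intro x hx
    have : {x} ∩ Y = {x} := by simpa using hx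
    exact ⟨{x}, h3 x (hY hx), this.symm, by rw [this]; simp⟩
  · rintro _ ⟨A, hA, rfl, -⟩ _ ⟨B, hB, rfl, -⟩
    have : (A ∩ Y) ∩ (B ∩ Y) = (A ∩ B) ∩ Y := by ext; simp; tauto
    rw [this]
    rcases h4 A hA B hB with h | h | h <;> simp [h]

theorem restrict_lift {X : Set α} {e : α} (hne : (X \ {e}).Nonempty) {T : Set (Set α)}
    (hT : T ∈ RP (X \ {e})) : restrictTree (X \ {e}) (liftTree X e T) = T := by
  obtain ⟨h1, h2, h3, h4⟩ := hT
  ext D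
  constructor
  · rintro ⟨C, (hC | rfl | rfl), rfl, hn⟩
    · rwa [Set.inter_eq_left.2 (h1 C hC).1]
    · rwa [Set.inter_eq_right.2 sdiff_subset]
    · obtain ⟨w, hw, hw'⟩ := hn
      exact absurd hw hw'.2
  · intro hD
    have : D ∩ (X \ {e}) = D := Set.inter_eq_left.2 (h1 D hD).1
    exact ⟨D, Or.inl hD, this.symm, by rw [this]; exact (h1 D hD).2⟩

theorem lift_restrict {X : Set α} {e : α} (he : e ∈ X) {U : Set (Set α)}
    (hU : U ∈ RP X) (hYU : X \ {e} ∈ U) : liftTree X e (restrictTree (X \ {e}) U) = U := by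
  obtain ⟨h1, h2, h3, h4⟩ := hU
  ext C
  constructor
  · rintro (⟨C, hC, rfl, hn⟩ | rfl | rfl)
    · rcases h4 C hC _ hYU with h | h | h
      · rw [h] at hn; exact absurd rfl hn.ne_empty
      · rwa [h]
      · rwa [h]
    · exact h2
    · exact h3 e he
  · intro hC
    have hCX := (h1 C hC).1
    have hCn := (h1 C hC).2
    rcases h4 C hC _ hYU with h | h | h
    · right; right
      refine mem_singleton_iff.2 (Set.Subset.antisymm ?_ ?_)
      · intro w hw
        by_contra hwe
        have : w ∈ C ∩ (X \ {e}) := ⟨hw, hCX hw, hwe⟩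
        rw [h] at this; exact this
      · rintro w rfl
        obtain ⟨v, hv⟩ := hCn
        by_cases hve : v = w
        · exact hve ▸ hv
        · have : v ∈ C ∩ (X \ {w}) := ⟨hv, hCX hv, hve⟩
          rw [h] at this; exact this.elim
    · left; exact ⟨C, hC, h.symm, by rwa [h]⟩
    · by_cases heC : e ∈ C
      · right; left
        refine Set.Subset.antisymm hCX ?_
        intro w hw
        by_cases hwe : w = e
        · exact hwe ▸ heC
        · exact (h.symm ▸ (⟨hw, hwe⟩ : w ∈ X \ {e}) : w ∈ C ∩ (X \ {e})).1
      · left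
        have : C ∩ (X \ {e}) = C := by
          apply Set.inter_eq_left.2; intro w hw; exact ⟨hCX hw, fun h => heC (h ▸ hw)⟩
        exact ⟨C, hC, this.symm, by rwa [this]⟩

theorem cluster_mem {X : Set α} (hfin : X.Finite) {e : α} (he : e ∈ X) (hne : (X \ {e}).Nonempty)
    {U : Set (Set α)} (hU : U ∈ RP X)
    (hd : ∀ x ∈ X \ {e}, ∀ y ∈ X \ {e}, x ≠ y → disp U x y e) : X \ {e} ∈ U := by
  obtain ⟨h1, h2, h3, h4⟩ := hU
  obtain ⟨x, hx⟩ := hne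
  let F : Set (Set α) := {C | C ∈ U ∧ x ∈ C ∧ e ∉ C}
  have hF : F.Finite := hfin.finite_subsets.subset (fun C hC => (h1 C hC.1).1)
  obtain ⟨C, hC⟩ := hF.exists_maximal
    ⟨{x}, h3 x hx.1, rfl, fun h => hx.2 (mem_singleton_iff.1 h).symm⟩
  obtain ⟨⟨hCU, hxC, heC⟩, hmax⟩ := hC
  have : C = X \ {e} := by
    apply Set.Subset.antisymm
    · intro w hw; exact ⟨(h1 C hCU).1 hw, fun h => heC (h ▸ hw)⟩
    · intro y hy
      by_cases hxy : x = y
      · exact hxy ▸ hxC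
      obtain ⟨D, hDU, hxD, hyD, heD⟩ := hd x hx y hy hxy
      rcases h4 C hCU D hDU with h | h | h
      · have : x ∈ C ∩ D := ⟨hxC, hxD⟩
        rw [h] at this; exact this.elim
      · exact hmax ⟨hDU, hxD, heD⟩ (Set.inter_eq_left.1 h) hyD
      · exact (Set.inter_eq_right.1 h) hyD
  exact this ▸ hCU

theorem Good.reduce {X : Set α} (hfin : X.Finite) {φ} (h : Good X φ) {e : α} (he : e ∈ X)
    (hne : (X \ {e}).Nonempty) : ∃ ψ, Good (X \ {e}) ψ := by
  have hdisp := @Good.pareto _ X φ h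
  obtain ⟨g1, g2, g3, g4, g5, g6⟩ := h
  set Y := X \ {e} with hY
  have hYX : Y ⊆ X := sdiff_subset
  have hl : ∀ T ∈ RP Y, liftTree X e T ∈ RP X := fun T hT => lift_mem he hT
  have hlY : ∀ T ∈ RP Y, ∀ x ∈ Y, ∀ y ∈ Y, disp (liftTree X e T) x y e := fun T hT x hx y hy =>
    ⟨Y, Or.inl hT.2.1, hx, hy, fun h => h.2 rfl⟩
  have key : ∀ T₁ ∈ RP Y, ∀ T₂ ∈ RP Y,
      liftTree X e (restrictTree Y (φ (liftTree X e T₁) (liftTree X e T₂))) =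
        φ (liftTree X e T₁) (liftTree X e T₂) := by
    intro T₁ hT₁ T₂ hT₂
    have hU := g1 _ (hl T₁ hT₁) _ (hl T₂ hT₂)
    refine lift_restrict he hU (cluster_mem hfin he hne hU ?_)
    intro x hx y hy hxy
    exact hdisp (hl T₁ hT₁) (hl T₂ hT₂) hx.1 hy.1 he hxy hx.2 hy.2
      (hlY T₁ hT₁ x hx y hy) (hlY T₂ hT₂ x hx y hy)
  refine ⟨fun T₁ T₂ => restrictTree Y (φ (liftTree X e T₁) (liftTree X e T₂)),
    ?_, ?_, ?_, ?_, ?_, ?_⟩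
  · intro T₁ hT₁ T₂ hT₂
    exact restrict_mem hYX hne (g1 _ (hl T₁ hT₁) _ (hl T₂ hT₂))
  · intro T hT
    simp only [g2 _ (hl T hT)]
    exact restrict_lift hne hT
  · intro T₁ hT₁ T₂ hT₂
    simp only [g3 _ (hl T₁ hT₁) _ (hl T₂ hT₂)]
  · intro T₁ hT₁ T₂ hT₂ T₃ hT₃
    simp only [key T₁ hT₁ T₂ hT₂, key T₂ hT₂ T₃ hT₃]
    rw [g4 _ (hl T₁ hT₁) _ (hl T₂ hT₂) _ (hl T₃ hT₃)]
  · intro σ hσ T₁ hT₁ T₂ hT₂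
    classical
    let τ : α → α := fun x => if x ∈ Y then σ x else x
    have τY : ∀ x ∈ Y, τ x = σ x := fun x hx => if_pos hx
    have heY : e ∉ Y := fun h => h.2 rfl
    have τe : τ e = e := if_neg heY
    have hXY : ∀ x ∈ X, x = e ∨ x ∈ Y := fun x hx => by
      by_cases h : x = e
      · exact Or.inl h
      · exact Or.inr ⟨hx, h⟩
    have hτ : Set.BijOn τ X X := by
      refine ⟨?_, ?_, ?_⟩
      · intro x hx
        rcases hXY x hx with rfl | hx
        · rwa [τe]
        · rw [τY x hx]; exact hYX (hσ.1 hx)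
      · intro x hx y hy hxy
        rcases hXY x hx with rfl | hx <;> rcases hXY y hy with rfl | hy
        · rfl
        · rw [τe, τY y hy] at hxy; exact absurd (hxy ▸ hσ.1 hy) heY
        · rw [τe, τY x hx] at hxy; exact absurd (hxy ▸ hσ.1 hx) heY
        · rw [τY x hx, τY y hy] at hxy; exact hσ.2.1 hx hy hxy
      · intro x hx
        rcases hXY x hx with rfl | hx
        · exact ⟨x, he, τe⟩
        · obtain ⟨y, hy, rfl⟩ := hσ.2.2 hx
          exact ⟨y, hYX hy, τY y hy⟩
    have himg : ∀ C ⊆ Y, τ '' C = σ '' C := fun C hC =>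
      Set.image_congr (fun x hx => τY x (hC hx))
    have hml : ∀ T ∈ RP Y, mapTree τ (liftTree X e T) = liftTree X e (mapTree σ T) := by
      intro T hT
      have h1 : Set.image (Set.image τ) T = Set.image (Set.image σ) T :=
        Set.image_congr (fun C hC => himg C (hT.1 C hC).1)
      simp only [mapTree, liftTree, Set.image_union, h1, Set.image_pair, hτ.image_eq,
        Set.image_singleton, τe]
    have hU := g1 _ (hl T₁ hT₁) _ (hl T₂ hT₂)
    simp only []
    rw [← hml T₁ hT₁, ← hml T₂ hT₂, g5 τ hτ _ (hl T₁ hT₁) _ (hl T₂ hT₂)]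
    have hint : ∀ C ⊆ X, τ '' C ∩ Y = σ '' (C ∩ Y) := by
      intro C hC
      ext w
      constructor
      · rintro ⟨⟨x, hx, rfl⟩, hw⟩
        rcases hXY x (hC hx) with rfl | hxY
        · rw [τe] at hw; exact absurd hw heY
        · exact ⟨x, ⟨hx, hxY⟩, (τY x hxY).symm⟩
      · rintro ⟨x, ⟨hx, hxY⟩, rfl⟩
        exact ⟨⟨x, hx, τY x hxY⟩, hσ.1 hxY⟩
    ext D
    constructor
    · rintro ⟨_, ⟨C, hC, rfl⟩, rfl, hn⟩
      rw [hint C (hU.1 C hC).1] at hn ⊢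
      exact ⟨C ∩ Y, ⟨C, hC, rfl, hn.of_image⟩, rfl⟩
    · rintro ⟨_, ⟨C, hC, rfl, hn⟩, rfl⟩
      refine ⟨τ '' C, ⟨C, hC, rfl⟩, (hint C (hU.1 C hC).1).symm, ?_⟩
      rw [hint C (hU.1 C hC).1]; exact hn.image _
  · intro W hW hW3 T' hT' T₁ hT₁ T₂ hT₂ h₁ h₂
    have hmono : ∀ T, restrictTree W T ⊆ restrictTree W (liftTree X e T) := by
      rintro T D ⟨C, hC, h⟩
      exact ⟨C, Or.inl hC, h⟩
    intro D hD
    obtain ⟨C, hC, hDC, hn⟩ := g6 W (hW.trans hYX) hW3 T' hT' _ (hl T₁ hT₁) _ (hl T₂ hT₂)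
      (h₁.trans (hmono _)) (h₂.trans (hmono _)) hD
    have : C ∩ Y ∩ W = C ∩ W := by
      rw [Set.inter_assoc, Set.inter_eq_right.2 hW]
    refine ⟨C ∩ Y, ⟨C, hC, rfl, ?_⟩, by rw [this]; exact hDC, by rw [this]; exact hn⟩
    obtain ⟨w, hw, hw'⟩ := hn
    exact ⟨w, hw, hW hw'⟩

theorem reduce_to_five (n : ℕ) : ∀ X : Set α, X.Finite → X.ncard = n + 5 → (∃ φ, Good X φ) →
    ∃ Y : Set α, Y.Finite ∧ Y.ncard = 5 ∧ ∃ φ, Good Y φ := by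
  induction n with
  | zero => intro X hX hn h; exact ⟨X, hX, by simpa using hn, h⟩
  | succ n ih =>
    rintro X hX hn ⟨φ, h⟩
    obtain ⟨e, he⟩ : X.Nonempty := by
      rw [← Set.ncard_pos hX]; omega
    have hc : (X \ {e}).ncard = n + 5 := by
      rw [Set.ncard_sdiff_singleton_of_mem he]; omega
    exact ih (X \ {e}) (hX.subset sdiff_subset) hc
      (h.reduce hX he (by rw [← Set.ncard_pos (hX.subset sdiff_subset)]; omega))

/-! ### Finite codes of trees on five taxa -/

/-- Bit masks of the nontrivial proper subsets of a five element set. -/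
def subs : List ℕ := [3, 5, 6, 7, 9, 10, 11, 12, 13, 14, 15, 17, 18, 19, 20, 21, 22, 23, 24, 25, 26,
  27, 28, 29, 30]

def compat (a b : ℕ) : Bool := (a &&& b == 0) || (a &&& b == a) || (a &&& b == b)

def ok (s : List ℕ) : Bool :=
  (subs.filter (fun m => s.contains m) == s) && s.all fun a => s.all fun b => compat a b

def enum : List ℕ → List (List ℕ)
  | [] => [[]]
  | m :: ms => enum ms ++ ((enum ms).filter fun s => s.all fun b => compat m b).map (m :: ·)

theorem filter_mem_enum (q : ℕ → Bool) : ∀ l : List ℕ,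
    (∀ a ∈ l, ∀ b ∈ l, q a = true → q b = true → compat a b = true) → l.filter q ∈ enum l
  | [], _ => by simp [enum]
  | m :: ms, h => by
    have ih := filter_mem_enum q ms (fun a ha b hb => h a (by simp [ha]) b (by simp [hb]))
    by_cases hm : q m = true
    · rw [List.filter_cons_of_pos hm]
      simp only [enum, List.mem_append, List.mem_map, List.mem_filter]
      refine Or.inr ⟨_, ⟨ih, ?_⟩, rfl⟩
      rw [List.all_eq_true]
      intro b hb
      rw [List.mem_filter] at hb
      exact h m (by simp) b (by simp [hb.1]) hm hb.2
    · rw [List.filter_cons_of_neg hm]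
      simp only [enum, List.mem_append]
      exact Or.inl ih

theorem ok.mem_enum {s : List ℕ} (h : ok s = true) : s ∈ enum subs := by
  simp only [ok, Bool.and_eq_true, beq_iff_eq, List.all_eq_true] at h
  rw [← h.1]
  apply filter_mem_enum
  intro a _ b _ ha hb
  simp only [List.contains_iff_mem] at ha hb
  exact h.2 a ha b hb

def pg (p : List ℕ) (i : ℕ) : ℕ := p.getD i 0

def okp (p : List ℕ) : Bool :=
  (List.range 5).all fun i => decide (pg p i < 5) &&
    (List.range 5).all fun j => (i == j) || !(pg p i == pg p j)

def bt (p : List ℕ) (m i : ℕ) : ℕ := if m.testBit i then 2 ^ pg p i else 0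

def mm (p : List ℕ) (m : ℕ) : ℕ :=
  bt p m 0 ||| (bt p m 1 ||| (bt p m 2 ||| (bt p m 3 ||| bt p m 4)))

def act (p s : List ℕ) : List ℕ := subs.filter fun m => (s.map (mm p)).contains m

def dispb (s : List ℕ) (a b c : ℕ) : Bool :=
  s.any fun m => m.testBit a && (m.testBit b && !m.testBit c)

theorem testBit_mm (p : List ℕ) (m k : ℕ) :
    (mm p m).testBit k = true ↔ ∃ i < 5, m.testBit i = true ∧ pg p i = k := by
  have h : ∀ i, (bt p m i).testBit k = true ↔ m.testBit i = true ∧ pg p i = k := by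
    intro i
    unfold bt
    split_ifs with h <;> simp [h, Nat.testBit_two_pow]
  simp only [mm, Nat.testBit_or, Bool.or_eq_true, h]
  constructor
  · rintro (h | h | h | h | h)
    · exact ⟨0, by omega, h⟩
    · exact ⟨1, by omega, h⟩
    · exact ⟨2, by omega, h⟩
    · exact ⟨3, by omega, h⟩
    · exact ⟨4, by omega, h⟩
  · rintro ⟨i, hi, h⟩
    interval_cases i <;> tauto

structure Op5 (f : List ℕ → List ℕ → List ℕ) : Prop where
  mem : ∀ s t, ok s = true → ok t = true → ok (f s t) = true
  idem : ∀ s, ok s = true → f s s = s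
  comm : ∀ s t, ok s = true → ok t = true → f s t = f t s
  assoc : ∀ s t u, ok s = true → ok t = true → ok u = true → f (f s t) u = f s (f t u)
  neut : ∀ p s t, okp p = true → ok s = true → ok t = true → f (act p s) (act p t) = act p (f s t)
  par : ∀ s t a b c, ok s = true → ok t = true → a < 5 → b < 5 → c < 5 → a ≠ b → a ≠ c → b ≠ c →
    dispb s a b c = true → dispb t a b c = true → dispb (f s t) a b c = true

section Codes

variable (e : ℕ → α)

def SS (m : ℕ) : Set α := {x | ∃ i < 5, m.testBit i = true ∧ e i = x}

def XX : Set α := {x | ∃ i < 5, e i = x}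

def InjE : Prop := ∀ i < 5, ∀ j < 5, e i = e j → i = j

def tree (s : List ℕ) : Set (Set α) :=
  {C | C = XX e ∨ (∃ x ∈ XX e, C = {x}) ∨ ∃ m ∈ s, C = SS e m}

open Classical in
noncomputable def code (T : Set (Set α)) : List ℕ := subs.filter fun m => decide (SS e m ∈ T)

variable {e}

theorem mem_SS (he : InjE e) {i m : ℕ} (hi : i < 5) : e i ∈ SS e m ↔ m.testBit i = true := by
  constructor
  · rintro ⟨j, hj, h, h'⟩
    rwa [← he j hj i hi h']
  · intro h; exact ⟨i, hi, h, rfl⟩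

theorem SS_sub (m : ℕ) : SS e m ⊆ XX e := fun _ ⟨i, hi, _, h⟩ => ⟨i, hi, h⟩

theorem exists_mask (he : InjE e) (C : Set α) (hC : C ⊆ XX e) : ∃ m < 32, C = SS e m := by
  classical
  let b : ℕ → ℕ := fun i => if e i ∈ C then 2 ^ i else 0
  have hb : ∀ i k, (b i).testBit k = true ↔ e i ∈ C ∧ i = k := by
    intro i k
    simp only [b]
    split_ifs with h <;> simp [h, Nat.testBit_two_pow]
  have hlt : ∀ i < 5, b i < 2 ^ 5 := by
    intro i hi
    simp only [b]
    split_ifs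
    · exact Nat.pow_lt_pow_right (by norm_num) hi
    · norm_num
  refine ⟨b 0 ||| (b 1 ||| (b 2 ||| (b 3 ||| b 4))), ?_, ?_⟩
  · exact Nat.or_lt_two_pow (hlt 0 (by omega)) (Nat.or_lt_two_pow (hlt 1 (by omega))
      (Nat.or_lt_two_pow (hlt 2 (by omega)) (Nat.or_lt_two_pow (hlt 3 (by omega)) (hlt 4 (by omega)))))
  · have key : ∀ i < 5, (b 0 ||| (b 1 ||| (b 2 ||| (b 3 ||| b 4)))).testBit i = true ↔ e i ∈ C := by
      intro i hi
      simp only [Nat.testBit_or, Bool.or_eq_true, hb]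
      interval_cases i <;> simp
    ext x
    constructor
    · intro hx
      obtain ⟨i, hi, rfl⟩ := hC hx
      exact (mem_SS he hi).2 ((key i hi).2 hx)
    · rintro ⟨i, hi, h, rfl⟩
      exact (key i hi).1 h

theorem SS_inj (he : InjE e) {m m' : ℕ} (hm : m < 32) (hm' : m' < 32) (h : SS e m = SS e m') :
    m = m' := by
  apply Nat.eq_of_testBit_eq
  intro i
  by_cases hi : i < 5
  · rw [Bool.eq_iff_iff, ← mem_SS he hi, h, mem_SS he hi]
  · have : 2 ^ 5 ≤ 2 ^ i := Nat.pow_le_pow_right (by norm_num) (by omega)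
    rw [Nat.testBit_lt_two_pow (by omega), Nat.testBit_lt_two_pow (by omega)]

theorem SS_full : SS e 31 = XX e := by
  ext x
  constructor
  · exact fun h => SS_sub _ h
  · rintro ⟨i, hi, rfl⟩
    refine ⟨i, hi, ?_, rfl⟩
    interval_cases i <;> rfl

theorem SS_zero : SS e 0 = ∅ := by
  ext x; simp [SS]

theorem SS_single {i : ℕ} (hi : i < 5) : SS e (2 ^ i) = {e i} := by
  ext x
  simp only [SS, Nat.testBit_two_pow, decide_eq_true_eq, mem_ofPred_eq, mem_singleton_iff]
  constructor
  · rintro ⟨j, _, rfl, rfl⟩; rfl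
  · rintro rfl; exact ⟨i, hi, rfl, rfl⟩

theorem SS_inter (he : InjE e) (a b : ℕ) : SS e a ∩ SS e b = SS e (a &&& b) := by
  ext x
  constructor
  · rintro ⟨⟨i, hi, h, rfl⟩, h'⟩
    rw [mem_SS he hi] at h' ⊢
    simp [h, h']
  · rintro ⟨i, hi, h, rfl⟩
    rw [mem_inter_iff, mem_SS he hi, mem_SS he hi]
    simpa using h

theorem mask_cases : ∀ m < 32, m = 0 ∨ m = 31 ∨ (∃ i < 5, m = 2 ^ i) ∨ m ∈ subs := by
  decide +kernel

theorem subs_spec : ∀ m ∈ subs, m < 32 ∧ m ≠ 0 ∧ m ≠ 31 ∧ ∀ i < 5, m ≠ 2 ^ i := by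
  decide +kernel

theorem compat_iff (he : InjE e) {a b : ℕ} (ha : a < 32) (hb : b < 32) :
    compat a b = true ↔
      (SS e a ∩ SS e b = ∅ ∨ SS e a ∩ SS e b = SS e a ∨ SS e a ∩ SS e b = SS e b) := by
  have hab : a &&& b < 32 := lt_of_le_of_lt Nat.and_le_left ha
  rw [SS_inter he, ← SS_zero (e := e)]
  simp only [compat, Bool.or_eq_true, beq_iff_eq]
  constructor
  · rintro ((h | h) | h)
    · left; rw [h]
    · right; left; rw [h]
    · right; right; rw [h]
  · rintro (h | h | h)
    · left; left; exact SS_inj he hab (by norm_num) h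
    · left; right; exact SS_inj he hab ha h
    · right; exact SS_inj he hab hb h

theorem code_ok (he : InjE e) {T : Set (Set α)} (hT : T ∈ RP (XX e)) : ok (code e T) = true := by
  classical
  simp only [ok, Bool.and_eq_true, beq_iff_eq, List.all_eq_true]
  constructor
  · apply List.filter_congr
    intro m hm
    rw [Bool.eq_iff_iff, List.contains_iff_mem, code, List.mem_filter]
    simp [hm]
  · intro a ha b hb
    simp only [code, List.mem_filter, decide_eq_true_eq] at ha hb
    exact (compat_iff he (subs_spec a ha.1).1 (subs_spec b hb.1).1).2
      (hT.2.2.2 _ ha.2 _ hb.2)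

theorem ok_subs {s : List ℕ} (hs : ok s = true) : ∀ m ∈ s, m ∈ subs := by
  simp only [ok, Bool.and_eq_true, beq_iff_eq, List.all_eq_true] at hs
  intro m hm
  rw [← hs.1] at hm
  exact (List.mem_filter.1 hm).1

theorem tree_mem (he : InjE e) {s : List ℕ} (hs : ok s = true) : tree e s ∈ RP (XX e) := by
  have hsub := ok_subs hs
  simp only [ok, Bool.and_eq_true, beq_iff_eq, List.all_eq_true] at hs
  have hA : ∀ C ∈ tree e s, C ⊆ XX e ∧ C.Nonempty := by
    rintro C (rfl | ⟨x, hx, rfl⟩ | ⟨m, hm, rfl⟩)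
    · exact ⟨subset_rfl, ⟨e 0, 0, by norm_num, rfl⟩⟩
    · exact ⟨by simpa using hx, by simp⟩
    · refine ⟨SS_sub m, ?_⟩
      by_contra h
      rw [Set.not_nonempty_iff_eq_empty, ← SS_zero (e := e)] at h
      have := subs_spec m (hsub m hm)
      exact this.2.1 (SS_inj he this.1 (by norm_num) h)
  refine ⟨hA, Or.inl rfl, fun x hx => Or.inr (Or.inl ⟨x, hx, rfl⟩), ?_⟩
  have hsing : ∀ (x : α) (B : Set α), {x} ∩ B = ∅ ∨ {x} ∩ B = {x} := by
    intro x B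
    by_cases h : x ∈ B
    · right; simpa using h
    · left; simpa using h
  intro A hA' B hB'
  have hA2 := hA A hA'
  have hB2 := hA B hB'
  rcases hA' with rfl | ⟨x, hx, rfl⟩ | ⟨m, hm, rfl⟩
  · right; right; exact inter_eq_right.2 hB2.1
  · rcases hsing x B with h | h
    · exact Or.inl h
    · exact Or.inr (Or.inl h)
  · rcases hB' with rfl | ⟨x, hx, rfl⟩ | ⟨m', hm', rfl⟩
    · right; left; exact inter_eq_left.2 hA2.1
    · rw [inter_comm]
      rcases hsing x (SS e m) with h | h
      · exact Or.inl h
      · exact Or.inr (Or.inr h)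
    · exact (compat_iff he (subs_spec m (hsub m hm)).1 (subs_spec m' (hsub m' hm')).1).1
        (hs.2 m hm m' hm')

theorem code_tree (he : InjE e) {s : List ℕ} (hs : subs.filter (fun m => s.contains m) = s) :
    code e (tree e s) = s := by
  classical
  conv_rhs => rw [← hs]
  apply List.filter_congr
  intro m hm
  have hsp := subs_spec m hm
  rw [Bool.eq_iff_iff, List.contains_iff_mem, decide_eq_true_eq]
  constructor
  · rintro (h | ⟨x, ⟨i, hi, rfl⟩, h⟩ | ⟨m', hm', h⟩)
    · rw [← SS_full] at h
      exact absurd (SS_inj he hsp.1 (by norm_num) h) hsp.2.2.1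
    · rw [← SS_single hi] at h
      refine absurd (SS_inj he hsp.1 ?_ h) (hsp.2.2.2 i hi)
      exact Nat.pow_lt_pow_right (by norm_num) hi
    · have hm2 : m' ∈ subs := by rw [← hs] at hm'; exact (List.mem_filter.1 hm').1
      rwa [SS_inj he hsp.1 (subs_spec m' hm2).1 h]
  · intro h; exact Or.inr (Or.inr ⟨m, h, rfl⟩)

theorem code_tree' (he : InjE e) {s : List ℕ} (hs : ok s = true) : code e (tree e s) = s := by
  apply code_tree he
  simp only [ok, Bool.and_eq_true, beq_iff_eq] at hs
  exact hs.1

theorem tree_code (he : InjE e) {T : Set (Set α)} (hT : T ∈ RP (XX e)) :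
    tree e (code e T) = T := by
  classical
  ext C
  constructor
  · rintro (rfl | ⟨x, hx, rfl⟩ | ⟨m, hm, rfl⟩)
    · exact hT.2.1
    · exact hT.2.2.1 x hx
    · simp only [code, List.mem_filter, decide_eq_true_eq] at hm
      exact hm.2
  · intro hC
    obtain ⟨m, hm, rfl⟩ := exists_mask he C (hT.1 C hC).1
    rcases mask_cases m hm with rfl | rfl | ⟨i, hi, rfl⟩ | h
    · have := (hT.1 _ hC).2
      rw [SS_zero] at this
      exact absurd this (by simp)
    · exact Or.inl SS_full
    · exact Or.inr (Or.inl ⟨e i, ⟨i, hi, rfl⟩, SS_single hi⟩)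
    · refine Or.inr (Or.inr ⟨m, ?_, rfl⟩)
      simp only [code, List.mem_filter, decide_eq_true_eq]
      exact ⟨h, hC⟩

theorem okp_spec {p : List ℕ} (hp : okp p = true) :
    (∀ i < 5, pg p i < 5) ∧ ∀ i < 5, ∀ j < 5, pg p i = pg p j → i = j := by
  simp only [okp, List.all_eq_true, List.mem_range, Bool.and_eq_true, decide_eq_true_eq,
    Bool.or_eq_true, beq_iff_eq, Bool.not_eq_true', beq_eq_false_iff_ne] at hp
  refine ⟨fun i hi => (hp i hi).1, fun i hi j hj h => ?_⟩
  rcases (hp i hi).2 j hj with h' | h'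
  · exact h'
  · exact absurd h h'

theorem exists_sigma (he : InjE e) {p : List ℕ} (hp : okp p = true) :
    ∃ σ : α → α, (∀ i < 5, σ (e i) = e (pg p i)) ∧ BijOn σ (XX e) (XX e) := by
  classical
  obtain ⟨h1, h2⟩ := okp_spec hp
  let σ : α → α := fun x => if h : ∃ i < 5, e i = x then e (pg p h.choose) else x
  have hσ : ∀ i < 5, σ (e i) = e (pg p i) := by
    intro i hi
    have h : ∃ j < 5, e j = e i := ⟨i, hi, rfl⟩
    simp only [σ, dif_pos h]
    rw [he _ h.choose_spec.1 i hi h.choose_spec.2]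
  have hfin : (XX e).Finite := by
    have : XX e = e '' (Set.Iio 5) := by ext x; simp [XX]
    rw [this]; exact (Set.finite_Iio 5).image e
  have hmaps : MapsTo σ (XX e) (XX e) := by
    rintro x ⟨i, hi, rfl⟩
    rw [hσ i hi]; exact ⟨_, h1 i hi, rfl⟩
  have hinj : InjOn σ (XX e) := by
    rintro x ⟨i, hi, rfl⟩ y ⟨j, hj, rfl⟩ h
    rw [hσ i hi, hσ j hj] at h
    rw [h2 i hi j hj (he _ (h1 i hi) _ (h1 j hj) h)]
  exact ⟨σ, hσ, (hfin.injOn_iff_bijOn_of_mapsTo hmaps).1 hinj⟩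

theorem image_SS {p : List ℕ} (hp : okp p = true) {σ : α → α}
    (hσ : ∀ i < 5, σ (e i) = e (pg p i)) (m : ℕ) : σ '' SS e m = SS e (mm p m) := by
  ext x
  constructor
  · rintro ⟨_, ⟨i, hi, h, rfl⟩, rfl⟩
    exact ⟨pg p i, (okp_spec hp).1 i hi, (testBit_mm p m _).2 ⟨i, hi, h, rfl⟩, (hσ i hi).symm⟩
  · rintro ⟨k, hk, h, rfl⟩
    obtain ⟨i, hi, h', rfl⟩ := (testBit_mm p m k).1 h
    exact ⟨e i, ⟨i, hi, h', rfl⟩, hσ i hi⟩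

theorem mm_lt {p : List ℕ} (hp : okp p = true) (m : ℕ) : mm p m < 32 := by
  have hlt : ∀ i < 5, bt p m i < 2 ^ 5 := by
    intro i hi
    simp only [bt]
    split_ifs
    · exact Nat.pow_lt_pow_right (by norm_num) ((okp_spec hp).1 i hi)
    · norm_num
  exact Nat.or_lt_two_pow (hlt 0 (by omega)) (Nat.or_lt_two_pow (hlt 1 (by omega))
      (Nat.or_lt_two_pow (hlt 2 (by omega)) (Nat.or_lt_two_pow (hlt 3 (by omega)) (hlt 4 (by omega)))))

theorem tree_act (he : InjE e) {p : List ℕ} (hp : okp p = true) {σ : α → α}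
    (hσ : ∀ i < 5, σ (e i) = e (pg p i)) (hbij : BijOn σ (XX e) (XX e)) {s : List ℕ}
    (hs : ok s = true) : tree e (act p s) = mapTree σ (tree e s) := by
  ext C
  constructor
  · rintro (rfl | ⟨x, hx, rfl⟩ | ⟨m, hm, rfl⟩)
    · exact ⟨XX e, Or.inl rfl, hbij.image_eq⟩
    · obtain ⟨y, hy, rfl⟩ := hbij.surjOn hx
      exact ⟨{y}, Or.inr (Or.inl ⟨y, hy, rfl⟩), by simp⟩
    · simp only [act, List.mem_filter, List.contains_iff_mem, List.mem_map] at hm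
      obtain ⟨_, m', hm', rfl⟩ := hm
      exact ⟨SS e m', Or.inr (Or.inr ⟨m', hm', rfl⟩), image_SS hp hσ m'⟩
  · rintro ⟨D, hD, rfl⟩
    have hne := ((tree_mem he hs).1 D hD).2
    rcases hD with rfl | ⟨x, hx, rfl⟩ | ⟨m, hm, rfl⟩
    · exact Or.inl hbij.image_eq
    · exact Or.inr (Or.inl ⟨σ x, hbij.mapsTo hx, by simp⟩)
    · have hne' := hne.image σ
      rw [image_SS hp hσ] at hne' ⊢
      rcases mask_cases (mm p m) (mm_lt hp m) with h | h | ⟨i, hi, h⟩ | h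
      · rw [h, SS_zero] at hne'
        exact absurd hne' (by simp)
      · rw [h]; exact Or.inl SS_full
      · rw [h]; exact Or.inr (Or.inl ⟨e i, ⟨i, hi, rfl⟩, SS_single hi⟩)
      · refine Or.inr (Or.inr ⟨_, ?_, rfl⟩)
        simp only [act, List.mem_filter, List.contains_iff_mem, List.mem_map]
        exact ⟨h, m, hm, rfl⟩

theorem dispb_iff (he : InjE e) {s : List ℕ} {a b c : ℕ} (ha : a < 5)
    (hb : b < 5) (hc : c < 5) (hab : a ≠ b) :
    dispb s a b c = true ↔ disp (tree e s) (e a) (e b) (e c) := by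
  simp only [dispb, List.any_eq_true, Bool.and_eq_true, Bool.not_eq_true']
  constructor
  · rintro ⟨m, hm, h1, h2, h3⟩
    refine ⟨SS e m, Or.inr (Or.inr ⟨m, hm, rfl⟩), ?_⟩
    rw [mem_SS he ha, mem_SS he hb, mem_SS he hc]
    simp [h1, h2, h3]
  · rintro ⟨C, rfl | ⟨x, hx, rfl⟩ | ⟨m, hm, rfl⟩, h1, h2, h3⟩
    · exact absurd ⟨c, hc, rfl⟩ h3
    · rw [mem_singleton_iff] at h1 h2
      exact absurd (he a ha b hb (h1.trans h2.symm)) hab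
    · rw [mem_SS he ha] at h1
      rw [mem_SS he hb] at h2
      rw [mem_SS he hc] at h3
      exact ⟨m, hm, h1, h2, by simpa using h3⟩

theorem Good.op5 (he : InjE e) {φ} (h : Good (XX e) φ) :
    Op5 fun s t => code e (φ (tree e s) (tree e t)) := by
  have hpar := @Good.pareto _ _ _ h
  obtain ⟨g1, g2, g3, g4, g5, _⟩ := h
  have hm : ∀ {s}, ok s = true → tree e s ∈ RP (XX e) := fun hs => tree_mem he hs
  constructor
  · intro s t hs ht
    exact code_ok he (g1 _ (hm hs) _ (hm ht))
  · intro s hs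
    rw [g2 _ (hm hs), code_tree' he hs]
  · intro s t hs ht
    rw [g3 _ (hm hs) _ (hm ht)]
  · intro s t u hs ht hu
    rw [tree_code he (g1 _ (hm hs) _ (hm ht)), tree_code he (g1 _ (hm ht) _ (hm hu)),
      g4 _ (hm hs) _ (hm ht) _ (hm hu)]
  · intro p s t hp hs ht
    obtain ⟨σ, hσ, hbij⟩ := exists_sigma he hp
    have hU := g1 _ (hm hs) _ (hm ht)
    rw [tree_act he hp hσ hbij hs, tree_act he hp hσ hbij ht, g5 σ hbij _ (hm hs) _ (hm ht)]
    have h2 := tree_act he hp hσ hbij (code_ok he hU)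
    rw [tree_code he hU] at h2
    rw [← h2]
    apply code_tree he
    apply List.filter_congr
    intro m hm
    rw [Bool.eq_iff_iff, List.contains_iff_mem, act, List.mem_filter]
    simp [hm]
  · intro s t a b c hs ht ha hb hc hab hac hbc h1 h2
    rw [dispb_iff he ha hb hc hab] at h1 h2 ⊢
    rw [tree_code he (g1 _ (hm hs) _ (hm ht))]
    exact hpar (hm hs) (hm ht) ⟨a, ha, rfl⟩ ⟨b, hb, rfl⟩ ⟨c, hc, rfl⟩
      (fun h => hab (he _ ha _ hb h)) (fun h => hac (he _ ha _ hc h))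
      (fun h => hbc (he _ hb _ hc h)) h1 h2

end Codes

theorem exists_op5 {X : Set α} (hX : X.Finite) (hc : X.ncard = 5) {φ} (h : Good X φ) :
    ∃ f, Op5 f := by
  obtain ⟨x0, hx0⟩ : X.Nonempty := by
    rw [← Set.ncard_pos hX]; omega
  have : Fintype X := hX.fintype
  have hcard : Fintype.card X = 5 := by rw [← hc, Set.ncard_eq_toFinset_card' X, Set.toFinset_card]
  let E : X ≃ Fin 5 := Fintype.equivFinOfCardEq hcard
  let e : ℕ → α := fun i => if h : i < 5 then (E.symm ⟨i, h⟩ : α) else x0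
  have he : InjE e := by
    intro i hi j hj hij
    simp only [e, dif_pos hi, dif_pos hj] at hij
    simpa using E.symm.injective (Subtype.ext hij)
  have hXX : XX e = X := by
    ext x
    constructor
    · rintro ⟨i, hi, rfl⟩
      simp only [e, dif_pos hi]
      exact Subtype.coe_prop _
    · intro hx
      refine ⟨E ⟨x, hx⟩, (E ⟨x, hx⟩).2, ?_⟩
      simp [e]
  rw [← hXX] at h
  exact ⟨_, h.op5 he⟩

/-! ### The induced order and its rules -/

def le (f : List ℕ → List ℕ → List ℕ) (i j : List ℕ) : Prop :=
  ok i = true ∧ ok j = true ∧ f i j = i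

variable {f : List ℕ → List ℕ → List ℕ}

theorem le.mv (hf : Op5 f) {i j : List ℕ} (h : le f i j) {p : List ℕ} (hp : okp p = true)
    (h1 : ok (act p i) = true) (h2 : ok (act p j) = true) : le f (act p i) (act p j) :=
  ⟨h1, h2, by rw [hf.neut p i j hp h.1 h.2.1, h.2.2]⟩

theorem le.tr (hf : Op5 f) {i j k : List ℕ} (h : le f i j) (h' : le f j k) : le f i k :=
  ⟨h.1, h'.2.1, by
    conv_lhs => rw [← h.2.2]
    rw [hf.assoc i j k h.1 h.2.1 h'.2.1, h'.2.2, h.2.2]⟩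

theorem rfle (hf : Op5 f) (i : List ℕ) (h : ok i = true) : le f i i := ⟨h, h, hf.idem i h⟩

theorem TR (hf : Op5 f) (p q : List ℕ) {i₁ j₁ i₂ j₂ i₃ j₃ : List ℕ} (h₁ : le f i₁ j₁)
    (h₂ : le f i₂ j₂) (c : (okp p && okp q && ok i₃ && ok j₃ && ok (act p j₁) && act p i₁ == i₃ &&
      act p j₁ == act q i₂ && act q j₂ == j₃) = true) : le f i₃ j₃ := by
  simp only [Bool.and_eq_true, beq_iff_eq] at c
  obtain ⟨⟨⟨⟨⟨⟨⟨c1, c2⟩, c3⟩, c4⟩, c5⟩, rfl⟩, c7⟩, rfl⟩ := c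
  have a := h₁.mv hf c1 c3 c5
  have b := h₂.mv hf c2 (c7 ▸ c5) c4
  rw [← c7] at b
  exact a.tr hf b

theorem AN (hf : Op5 f) (p : List ℕ) {a b c d : List ℕ} (h₁ : le f a b) (h₂ : le f c d)
    (h : (okp p && act p c == b && act p d == a && !(a == b)) = true) : False := by
  simp only [Bool.and_eq_true, beq_iff_eq, Bool.not_eq_true', beq_eq_false_iff_ne] at h
  obtain ⟨⟨⟨c1, rfl⟩, rfl⟩, c4⟩ := h
  have e := h₂.mv hf c1 h₁.2.1 h₁.1
  apply c4
  rw [← h₁.2.2, hf.comm _ _ h₁.1 h₁.2.1, e.2.2]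

theorem ML (hf : Op5 f) (r : List ℕ) {i j k a b : List ℕ} (h : f i j = k)
    (c : (okp r && ok i && ok j && ok a && ok b && act r k == a && act r i == b) = true) :
    le f a b := by
  simp only [Bool.and_eq_true, beq_iff_eq] at c
  obtain ⟨⟨⟨⟨⟨⟨c1, c2⟩, c3⟩, c4⟩, c5⟩, rfl⟩, rfl⟩ := c
  have hk : ok k = true := h ▸ hf.mem i j c2 c3
  refine le.mv hf ⟨hk, c2, ?_⟩ c1 c4 c5
  rw [hf.comm k i hk c2, ← h, ← hf.assoc i i j c2 c2 c3, hf.idem i c2]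

theorem MR (hf : Op5 f) (r : List ℕ) {i j k a b : List ℕ} (h : f i j = k)
    (c : (okp r && ok j && ok i && ok a && ok b && act r k == a && act r j == b) = true) :
    le f a b := by
  refine ML hf r (i := j) (j := i) (k := k) ?_ c
  simp only [Bool.and_eq_true, beq_iff_eq] at c
  obtain ⟨⟨⟨⟨⟨⟨c1, c2⟩, c3⟩, c4⟩, c5⟩, c6⟩, c7⟩ := c
  rw [hf.comm j i c2 c3, h]

theorem GB (hf : Op5 f) (r p q : List ℕ) {i j k a₁ b₁ a₂ b₂ a₃ b₃ : List ℕ} (h : f i j = k)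
    (h₁ : le f a₁ b₁) (h₂ : le f a₂ b₂)
    (c : (okp r && okp p && okp q && ok i && ok j && ok (act p a₁) && ok a₃ && ok b₃ &&
      act p a₁ == act q a₂ && act p b₁ == i && act q b₂ == j && act r (act p a₁) == a₃ &&
      act r k == b₃) = true) : le f a₃ b₃ := by
  simp only [Bool.and_eq_true, beq_iff_eq] at c
  obtain ⟨⟨⟨⟨⟨⟨⟨⟨⟨⟨⟨⟨c1, c2⟩, c3⟩, ci⟩, cj⟩, c4⟩, c5⟩, c6⟩, c7⟩, rfl⟩, rfl⟩, rfl⟩, rfl⟩ := c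
  have hk : ok k = true := h ▸ hf.mem _ _ ci cj
  have e1 := h₁.mv hf c2 c4 ci
  have e2 := h₂.mv hf c3 (c7 ▸ c4) cj
  rw [← c7] at e2
  refine le.mv hf ⟨c4, hk, ?_⟩ c1 c5 c6
  rw [← h, ← hf.assoc _ _ _ c4 ci cj, e1.2.2, e2.2.2]

def bigchk (i j : List ℕ) (ts : List (ℕ × ℕ × ℕ)) (ps cs : List (List ℕ)) : Bool :=
  ok i && ok j &&
  (ts.all fun t => decide (t.1 < 5) && decide (t.2.1 < 5) && decide (t.2.2 < 5) &&
    !(t.1 == t.2.1) && !(t.1 == t.2.2) && !(t.2.1 == t.2.2) &&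
    dispb i t.1 t.2.1 t.2.2 && dispb j t.1 t.2.1 t.2.2) &&
  (ps.all fun p => okp p &&
    ((act p i == i && act p j == j) || (act p i == j && act p j == i))) &&
  ((enum subs).all fun k => (ts.any fun t => !dispb k t.1 t.2.1 t.2.2) ||
    ((ps.any fun p => !(act p k == k)) || cs.contains k))

theorem BG (hf : Op5 f) (i j : List ℕ) (ts : List (ℕ × ℕ × ℕ)) (ps : List (List ℕ))
    {cs : List (List ℕ)} (c : bigchk i j ts ps cs = true) : f i j ∈ cs := by
  simp only [bigchk, Bool.and_eq_true, List.all_eq_true] at c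
  obtain ⟨⟨⟨⟨hi, hj⟩, hts⟩, hps⟩, hall⟩ := c
  have hk := hf.mem i j hi hj
  have := hall _ (ok.mem_enum hk)
  simp only [Bool.or_eq_true, List.any_eq_true, List.contains_iff_mem] at this
  rcases this with ⟨t, ht, h⟩ | ⟨p, hp, h⟩ | h
  · obtain ⟨⟨⟨⟨⟨⟨⟨h1, h2⟩, h3⟩, h4⟩, h5⟩, h6⟩, h7⟩, h8⟩ := hts t ht
    simp only [decide_eq_true_eq, Bool.not_eq_true', beq_eq_false_iff_ne] at h1 h2 h3 h4 h5 h6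
    rw [hf.par i j _ _ _ hi hj h1 h2 h3 h4 h5 h6 h7 h8] at h
    simp at h
  · exfalso
    simp only [Bool.not_eq_true', beq_eq_false_iff_ne] at h
    apply h
    have h' := hps p hp
    simp only [Bool.or_eq_true, Bool.and_eq_true, beq_iff_eq] at h'
    rw [← hf.neut p i j h'.1 hi hj]
    rcases h'.2 with ⟨ha, hb⟩ | ⟨ha, hb⟩
    · rw [ha, hb]
    · rw [ha, hb, hf.comm j i hj hi]
  · exact h

theorem b0 (hf : Op5 f) : f [24,28,30] [20,28,30] = [28,30] ∨ f [24,28,30] [20,28,30] = [12,28,30] := by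
  simpa only [List.mem_cons, List.not_mem_nil, or_false] using BG hf [24,28,30] [20,28,30] [(1,2,0), (2,4,1)] [[0,1,3,2,4]] (cs := [[28,30], [12,28,30]]) (by decide +kernel)

theorem b1 (hf : Op5 f) : f [12,18,30] [10,20,30] = [30] ∨ f [12,18,30] [10,20,30] = [6,24,30] := by
  simpa only [List.mem_cons, List.not_mem_nil, or_false] using BG hf [12,18,30] [10,20,30] [(1,3,0)] [[0,3,4,2,1]] (cs := [[30], [6,24,30]]) (by decide +kernel)

theorem b2 (hf : Op5 f) : f [24,28,30] [24,26,30] = [24,30] ∨ f [24,28,30] [24,26,30] = [6,24,30] := by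
  simpa only [List.mem_cons, List.not_mem_nil, or_false] using BG hf [24,28,30] [24,26,30] [(1,3,0), (3,4,1)] [[0,2,1,4,3]] (cs := [[24,30], [6,24,30]]) (by decide +kernel)

theorem b3 (hf : Op5 f) : f [24,28,30] [12,18,30] = [28,30] ∨ f [24,28,30] [12,18,30] = [12,30] ∨ f [24,28,30] [12,18,30] = [20,28,30] ∨ f [24,28,30] [12,18,30] = [12,18,30] ∨ f [24,28,30] [12,18,30] = [12,28,30] ∨ f [24,28,30] [12,18,30] = [24,28,30] ∨ f [24,28,30] [12,18,30] = [12,14,30] := by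
  simpa only [List.mem_cons, List.not_mem_nil, or_false] using BG hf [24,28,30] [12,18,30] [(1,2,0), (2,3,1), (1,4,0)] [] (cs := [[28,30], [12,30], [20,28,30], [12,18,30], [12,28,30], [24,28,30], [12,14,30]]) (by decide +kernel)

theorem b4 (hf : Op5 f) : f [24,30] [6,30] = [30] ∨ f [24,30] [6,30] = [6,24,30] := by
  simpa only [List.mem_cons, List.not_mem_nil, or_false] using BG hf [24,30] [6,30] [(1,3,0)] [[0,3,4,2,1]] (cs := [[30], [6,24,30]]) (by decide +kernel)

theorem b5 (hf : Op5 f) : f [12,18,19] [12,17,19] = [12,19] ∨ f [12,18,19] [12,17,19] = [3,12,19] := by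
  simpa only [List.mem_cons, List.not_mem_nil, or_false] using BG hf [12,18,19] [12,17,19] [(0,4,2), (2,3,0)] [[1,0,3,2,4]] (cs := [[12,19], [3,12,19]]) (by decide +kernel)

theorem b6 (hf : Op5 f) : f [14,17] [12,19] = [12,17] ∨ f [14,17] [12,19] = [12,17,29] := by
  simpa only [List.mem_cons, List.not_mem_nil, or_false] using BG hf [14,17] [12,19] [(0,4,2)] [[2,1,4,0,3]] (cs := [[12,17], [12,17,29]]) (by decide +kernel)

theorem b7 (hf : Op5 f) : f [14,17] [12,18,19] = [12,17] ∨ f [14,17] [12,18,19] = [12,17,29] ∨ f [14,17] [12,18,19] = [12,19] ∨ f [14,17] [12,18,19] = [14,17] ∨ f [14,17] [12,18,19] = [12,18,19] ∨ f [14,17] [12,18,19] = [12,17,19] ∨ f [14,17] [12,18,19] = [12,14,17] ∨ f [14,17] [12,18,19] = [3,12,19] := by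
  simpa only [List.mem_cons, List.not_mem_nil, or_false] using BG hf [14,17] [12,18,19] [(0,4,2), (2,3,0)] [[0,1,3,2,4]] (cs := [[12,17], [12,17,29], [12,19], [14,17], [12,18,19], [12,17,19], [12,14,17], [3,12,19]]) (by decide +kernel)

theorem b8 (hf : Op5 f) : f [28,30] [28,29] = [3,28] ∨ f [28,30] [28,29] = [28] := by
  simpa only [List.mem_cons, List.not_mem_nil, or_false] using BG hf [28,30] [28,29] [(2,3,0)] [[1,0,3,4,2]] (cs := [[3,28], [28]]) (by decide +kernel)

theorem b9 (hf : Op5 f) : f [12,18] [10,20] = [] ∨ f [12,18] [10,20] = [6,24,30] ∨ f [12,18] [10,20] = [6,24] ∨ f [12,18] [10,20] = [30] := by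
  simpa only [List.mem_cons, List.not_mem_nil, or_false] using BG hf [12,18] [10,20] [] [[0,3,4,2,1]] (cs := [[], [6,24,30], [6,24], [30]]) (by decide +kernel)

theorem b10 (hf : Op5 f) : f [28] [19] = [] ∨ f [28] [19] = [3,12] ∨ f [28] [19] = [3,12,15] ∨ f [28] [19] = [15] := by
  simpa only [List.mem_cons, List.not_mem_nil, or_false] using BG hf [28] [19] [] [[2,3,1,0,4]] (cs := [[], [3,12], [3,12,15], [15]]) (by decide +kernel)

theorem b11 (hf : Op5 f) : f [24,28,30] [24,28,29] = [3,24,28] ∨ f [24,28,30] [24,28,29] = [24,28] := by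
  simpa only [List.mem_cons, List.not_mem_nil, or_false] using BG hf [24,28,30] [24,28,29] [(2,3,0), (3,4,2)] [[1,0,2,4,3]] (cs := [[3,24,28], [24,28]]) (by decide +kernel)

theorem b12 (hf : Op5 f) : f [24,28] [20,28] = [3,28] ∨ f [24,28] [20,28] = [3,12,28] ∨ f [24,28] [20,28] = [12,28] ∨ f [24,28] [20,28] = [28] := by
  simpa only [List.mem_cons, List.not_mem_nil, or_false] using BG hf [24,28] [20,28] [(2,4,0)] [[1,0,3,2,4]] (cs := [[3,28], [3,12,28], [12,28], [28]]) (by decide +kernel)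

theorem b13 (hf : Op5 f) : f [24,28,30] [18,19,27] = [26] ∨ f [24,28,30] [18,19,27] = [5,10,26] ∨ f [24,28,30] [18,19,27] = [5,26] ∨ f [24,28,30] [18,19,27] = [10,26] := by
  simpa only [List.mem_cons, List.not_mem_nil, or_false] using BG hf [24,28,30] [18,19,27] [(1,4,0)] [[2,3,0,1,4]] (cs := [[26], [5,10,26], [5,26], [10,26]]) (by decide +kernel)

theorem b14 (hf : Op5 f) : f [24,30] [20,29] = [28] ∨ f [24,30] [20,29] = [12,28] ∨ f [24,30] [20,29] = [3,12,28] ∨ f [24,30] [20,29] = [3,28] := by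
  simpa only [List.mem_cons, List.not_mem_nil, or_false] using BG hf [24,30] [20,29] [(2,4,0)] [[1,0,3,2,4]] (cs := [[28], [12,28], [3,12,28], [3,28]]) (by decide +kernel)

theorem b15 (hf : Op5 f) : f [24,30] [24,28] = [24,30] ∨ f [24,30] [24,28] = [24,28] ∨ f [24,30] [24,28] = [3,24,28] ∨ f [24,30] [24,28] = [6,24,30] ∨ f [24,30] [24,28] = [24,28,30] ∨ f [24,30] [24,28] = [24,26,30] ∨ f [24,30] [24,28] = [24,28,29] := by
  simpa only [List.mem_cons, List.not_mem_nil, or_false] using BG hf [24,30] [24,28] [(2,3,0), (3,4,2), (3,4,1)] [[0,1,2,4,3]] (cs := [[24,30], [24,28], [3,24,28], [6,24,30], [24,28,30], [24,26,30], [24,28,29]]) (by decide +kernel)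

theorem b16 (hf : Op5 f) : f [24,28,30] [6,22,30] = [30] ∨ f [24,28,30] [6,22,30] = [10,30] ∨ f [24,28,30] [6,22,30] = [20,30] ∨ f [24,28,30] [6,22,30] = [6,24,30] ∨ f [24,28,30] [6,22,30] = [10,20,30] ∨ f [24,28,30] [6,22,30] = [12,18,30] := by
  simpa only [List.mem_cons, List.not_mem_nil, or_false] using BG hf [24,28,30] [6,22,30] [(1,2,0), (1,3,0)] [[0,3,4,1,2]] (cs := [[30], [10,30], [20,30], [6,24,30], [10,20,30], [12,18,30]]) (by decide +kernel)

theorem b17 (hf : Op5 f) : f [24,28,30] [20,22,30] = [28,30] ∨ f [24,28,30] [20,22,30] = [20,30] ∨ f [24,28,30] [20,22,30] = [24,28,30] ∨ f [24,28,30] [20,22,30] = [20,28,30] ∨ f [24,28,30] [20,22,30] = [20,22,30] ∨ f [24,28,30] [20,22,30] = [12,28,30] ∨ f [24,28,30] [20,22,30] = [10,20,30] := by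
  simpa only [List.mem_cons, List.not_mem_nil, or_false] using BG hf [24,28,30] [20,22,30] [(1,2,0), (2,4,1), (1,3,0)] [] (cs := [[28,30], [20,30], [24,28,30], [20,28,30], [20,22,30], [12,28,30], [10,20,30]]) (by decide +kernel)

theorem l0 (hf : Op5 f) : ¬le f [30] [17,25,29] := by
  intro h
  have h0 : f [24,28,30] [12,18,30] ≠ [20,28,30] := fun g => (fun g' : le f [24,28,30] [20,28,30] => AN hf [0,1,3,2,4] g' g' (by decide +kernel)) (ML hf [0,1,3,2,4] g (by decide +kernel))
  have h1 : f [24,28,30] [20,28,30] ≠ [12,28,30] := fun g => (fun g' : le f [24,28,30] [20,28,30] => AN hf [0,1,3,2,4] g' g' (by decide +kernel)) (ML hf [0,1,3,4,2] g (by decide +kernel))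
  have h2 : f [24,28,30] [20,28,30] = [28,30] := by
    rcases b0 hf with g | g
    · exact g
    · exact absurd g h1
  have h3 : ¬le f [28,30] [25,29] := fun g => (fun g' : le f [28,30] [19,27] => AN hf [2,3,0,1,4] g' g' (by decide +kernel)) (TR hf [0,1,2,3,4] [1,2,3,0,4] g g (by decide +kernel))
  have h4 : ¬le f [28,30] [17,25,29] := fun g => h3 (GB hf [1,2,3,4,0] [4,0,1,2,3] [4,0,1,3,2] h2 g g (by decide +kernel))
  have h5 : ¬le f [28,30] [30] := fun g => h4 (TR hf [0,1,2,3,4] [0,1,2,3,4] g h (by decide +kernel))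
  have h6 : f [24,28,30] [12,18,30] ≠ [12,28,30] := fun g => (fun g' : le f [24,28,30] [20,28,30] => AN hf [0,1,3,2,4] g' g' (by decide +kernel)) (ML hf [0,1,3,4,2] g (by decide +kernel))
  have h7 : ¬le f [24,28,30] [18,26,30] := fun g => (fun g' : le f [24,28,30] [6,22,30] => AN hf [0,3,4,1,2] g' g' (by decide +kernel)) (TR hf [0,1,2,3,4] [0,2,3,4,1] g g (by decide +kernel))
  have h8 : f [24,28,30] [12,18,30] ≠ [12,14,30] := fun g => h7 (ML hf [0,2,3,4,1] g (by decide +kernel))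
  have h9 : f [12,18,30] [10,20,30] ≠ [6,24,30] := fun g => (fun g' : le f [12,18,30] [10,20,30] => AN hf [0,1,2,4,3] g' g' (by decide +kernel)) (ML hf [0,1,4,2,3] g (by decide +kernel))
  have h10 : f [12,18,30] [10,20,30] = [30] := by
    rcases b1 hf with g | g
    · exact g
    · exact absurd g h9
  have h11 : ¬le f [30] [12,17,29] := fun g => (fun g' : le f [30] [29] => AN hf [1,0,2,3,4] g' g' (by decide +kernel)) (GB hf [1,0,2,3,4] [1,0,2,3,4] [1,0,2,4,3] h10 g g (by decide +kernel))
  have h12 : f [24,28,30] [24,26,30] ≠ [6,24,30] := fun g => h11 (GB hf [1,2,3,0,4] [3,0,1,2,4] [3,0,2,1,4] g h h (by decide +kernel))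
  have h13 : f [24,28,30] [24,26,30] = [24,30] := by
    rcases b2 hf with g | g
    · exact g
    · exact absurd g h12
  have h14 : le f [30] [12,18,30] := ML hf [0,1,2,3,4] h10 (by decide +kernel)
  have h15 : ¬le f [12,18,30] [30] := fun g => (fun g' : le f [12,18,30] [10,20,30] => AN hf [0,1,2,4,3] g' g' (by decide +kernel)) (TR hf [0,1,2,3,4] [0,1,2,4,3] g h14 (by decide +kernel))
  have h16 : le f [30] [17,29] := GB hf [1,2,3,0,4] [3,0,1,2,4] [3,0,2,1,4] h13 h h (by decide +kernel)
  have h17 : ¬le f [24,30] [6,24,30] := fun g => h11 (TR hf [0,1,2,3,4] [1,2,3,0,4] h16 g (by decide +kernel))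
  have h18 : f [24,28,30] [12,18,30] ≠ [12,30] := fun g => h17 (MR hf [0,1,3,4,2] g (by decide +kernel))
  have h19 : ¬le f [28,30] [12,18,30] := fun g => h5 (GB hf [0,1,2,3,4] [0,1,2,3,4] [0,1,2,4,3] h10 g g (by decide +kernel))
  have h20 : f [24,28,30] [12,18,30] ≠ [28,30] := fun g => h19 (MR hf [0,1,2,3,4] g (by decide +kernel))
  have h21 : ¬le f [24,28,30] [12,18,30] := fun g => h11 (TR hf [0,1,2,4,3] [1,2,4,0,3] h g (by decide +kernel))
  have h22 : f [24,28,30] [12,18,30] ≠ [24,28,30] := fun g => h21 (MR hf [0,1,2,3,4] g (by decide +kernel))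
  have h23 : f [24,28,30] [12,18,30] = [12,18,30] := by
    rcases b3 hf with g | g | g | g | g | g | g
    · exact absurd g h20
    · exact absurd g h18
    · exact absurd g h0
    · exact g
    · exact absurd g h6
    · exact absurd g h22
    · exact absurd g h8
  have h24 : le f [12,18,30] [24,28,30] := ML hf [0,1,2,3,4] h23 (by decide +kernel)
  have h25 : le f [12,18,30] [24,30] := GB hf [0,1,2,3,4] [0,1,2,3,4] [0,2,1,4,3] h13 h24 h24 (by decide +kernel)
  have h26 : f [24,30] [6,30] ≠ [6,24,30] := fun g => (fun g' : le f [12,18,30] [10,20,30] => AN hf [0,1,2,4,3] g' g' (by decide +kernel)) (GB hf [0,1,3,2,4] [0,1,2,3,4] [0,3,4,1,2] g h25 h25 (by decide +kernel))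
  have h27 : f [24,30] [6,30] = [30] := by
    rcases b4 hf with g | g
    · exact g
    · exact absurd g h26
  exact h15 (GB hf [0,1,2,3,4] [0,1,2,3,4] [0,3,4,1,2] h27 h25 h25 (by decide +kernel))

theorem l1 (hf : Op5 f) : ¬le f [12,18,30] [24,28,30] := by
  intro h
  have h0 : f [24,28,30] [20,28,30] ≠ [12,28,30] := fun g => (fun g' : le f [24,28,30] [20,28,30] => AN hf [0,1,3,2,4] g' g' (by decide +kernel)) (ML hf [0,1,3,4,2] g (by decide +kernel))
  have h1 : f [24,28,30] [20,28,30] = [28,30] := by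
    rcases b0 hf with g | g
    · exact g
    · exact absurd g h0
  have h2 : le f [28,30] [24,28,30] := ML hf [0,1,2,3,4] h1 (by decide +kernel)
  have h3 : f [24,28,30] [24,26,30] ≠ [6,24,30] := fun g => (fun g' : le f [12,18,30] [10,20,30] => AN hf [0,1,2,4,3] g' g' (by decide +kernel)) (GB hf [0,1,3,2,4] [0,1,2,3,4] [0,2,1,4,3] g h h (by decide +kernel))
  have h4 : f [24,28,30] [24,26,30] = [24,30] := by
    rcases b2 hf with g | g
    · exact g
    · exact absurd g h3
  have h5 : f [12,18,30] [10,20,30] ≠ [6,24,30] := fun g => (fun g' : le f [12,18,30] [10,20,30] => AN hf [0,1,2,4,3] g' g' (by decide +kernel)) (ML hf [0,1,4,2,3] g (by decide +kernel))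
  have h6 : f [12,18,30] [10,20,30] = [30] := by
    rcases b1 hf with g | g
    · exact g
    · exact absurd g h5
  have h7 : le f [30] [12,18,30] := ML hf [0,1,2,3,4] h6 (by decide +kernel)
  have h8 : ¬le f [12,18,30] [30] := fun g => (fun g' : le f [12,18,30] [10,20,30] => AN hf [0,1,2,4,3] g' g' (by decide +kernel)) (TR hf [0,1,2,3,4] [0,1,2,4,3] g h7 (by decide +kernel))
  have h9 : le f [12,18,30] [24,30] := GB hf [0,1,2,3,4] [0,1,2,3,4] [0,2,1,4,3] h4 h h (by decide +kernel)
  have h10 : f [24,30] [6,30] ≠ [6,24,30] := fun g => (fun g' : le f [12,18,30] [10,20,30] => AN hf [0,1,2,4,3] g' g' (by decide +kernel)) (GB hf [0,1,3,2,4] [0,1,2,3,4] [0,3,4,1,2] g h9 h9 (by decide +kernel))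
  have h11 : le f [12,18,30] [28,30] := GB hf [0,1,2,3,4] [0,1,2,3,4] [0,1,3,2,4] h1 h h (by decide +kernel)
  have h12 : le f [12,18,30] [18,26,30] := TR hf [0,2,1,4,3] [0,2,3,1,4] h11 h2 (by decide +kernel)
  have h13 : le f [12,18,30] [18,30] := GB hf [0,2,3,1,4] [0,3,1,2,4] [0,3,2,1,4] h4 h12 h12 (by decide +kernel)
  have h14 : f [24,30] [6,30] ≠ [30] := fun g => h8 (GB hf [0,1,4,2,3] [0,3,1,2,4] [0,1,3,4,2] g h13 h13 (by decide +kernel))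
  exact by
    rcases b4 hf with g | g
    · exact absurd g h14
    · exact absurd g h10

theorem l2 (hf : Op5 f) : ¬le f [14,17] [28,30] := by
  intro h
  have h0 : f [12,18] [10,20] ≠ [6,24] := fun g => (fun g' : le f [12,18] [10,20] => AN hf [0,1,2,4,3] g' g' (by decide +kernel)) (ML hf [0,1,4,2,3] g (by decide +kernel))
  have h1 : f [14,17] [12,18,19] ≠ [12,19] := fun g => (fun g' : le f [14,17] [12,19] => AN hf [2,1,0,4,3] g' g' (by decide +kernel)) (ML hf [2,1,0,4,3] g (by decide +kernel))
  have h2 : f [12,18,19] [12,17,19] ≠ [3,12,19] := fun g => (fun g' : le f [12,18,19] [12,17,19] => AN hf [1,0,2,3,4] g' g' (by decide +kernel)) (ML hf [1,4,2,3,0] g (by decide +kernel))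
  have h3 : f [12,18,19] [12,17,19] = [12,19] := by
    rcases b5 hf with g | g
    · exact g
    · exact absurd g h2
  have h4 : le f [14,17] [12,14,17] := ML hf [1,2,0,4,3] h3 (by decide +kernel)
  have h5 : ¬le f [12,18,19] [10,17,21] := fun g => (fun g' : le f [12,18,19] [9,11,20] => AN hf [1,0,2,4,3] g' g' (by decide +kernel)) (TR hf [0,1,3,2,4] [3,4,1,2,0] g g (by decide +kernel))
  have h6 : ¬le f [12,18,19] [12,14,17] := fun g => h5 (TR hf [0,1,2,3,4] [1,2,0,4,3] g g (by decide +kernel))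
  have h7 : ¬le f [12,18,19] [14,17] := fun g => h6 (TR hf [0,1,2,3,4] [0,1,2,3,4] g h4 (by decide +kernel))
  have h8 : f [14,17] [12,18,19] ≠ [12,18,19] := fun g => h7 (ML hf [0,1,2,3,4] g (by decide +kernel))
  have h9 : f [14,17] [12,18,19] ≠ [12,17,19] := fun g => (fun g' : le f [12,18,19] [12,17,19] => AN hf [1,0,2,3,4] g' g' (by decide +kernel)) (MR hf [1,0,2,3,4] g (by decide +kernel))
  have h10 : ¬le f [12,18,19] [9,20,22] := fun g => (fun g' : le f [12,18,19] [9,11,20] => AN hf [1,0,2,4,3] g' g' (by decide +kernel)) (TR hf [0,4,3,2,1] [4,1,0,2,3] g g (by decide +kernel))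
  have h11 : ¬le f [12,18,19] [9,13,18] := fun g => h10 (TR hf [0,1,2,3,4] [2,0,1,4,3] g g (by decide +kernel))
  have h12 : f [14,17] [12,18,19] ≠ [12,14,17] := fun g => h11 (MR hf [2,0,1,4,3] g (by decide +kernel))
  have h13 : f [14,17] [12,18,19] ≠ [3,12,19] := fun g => (fun g' : le f [12,18,19] [12,17,19] => AN hf [1,0,2,3,4] g' g' (by decide +kernel)) (MR hf [1,4,2,3,0] g (by decide +kernel))
  have h14 : f [12,18,30] [10,20,30] ≠ [6,24,30] := fun g => (fun g' : le f [12,18,30] [10,20,30] => AN hf [0,1,2,4,3] g' g' (by decide +kernel)) (ML hf [0,1,4,2,3] g (by decide +kernel))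
  have h15 : f [12,18,30] [10,20,30] = [30] := by
    rcases b1 hf with g | g
    · exact g
    · exact absurd g h14
  have h16 : le f [30] [12,18,30] := ML hf [0,1,2,3,4] h15 (by decide +kernel)
  have h17 : f [24,28,30] [20,28,30] ≠ [12,28,30] := fun g => (fun g' : le f [24,28,30] [20,28,30] => AN hf [0,1,3,2,4] g' g' (by decide +kernel)) (ML hf [0,1,3,4,2] g (by decide +kernel))
  have h18 : f [24,28,30] [20,28,30] = [28,30] := by
    rcases b0 hf with g | g
    · exact g
    · exact absurd g h17
  have h19 : le f [28,30] [24,28,30] := ML hf [0,1,2,3,4] h18 (by decide +kernel)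
  have h20 : ¬le f [30] [25,29] := fun g => (l0 hf) (TR hf [0,1,2,3,4] [1,2,3,0,4] g h19 (by decide +kernel))
  have h21 : ¬le f [30] [13,18] := fun g => h20 (TR hf [0,1,2,3,4] [1,2,0,3,4] g h (by decide +kernel))
  have h22 : ¬le f [12,18,30] [19,27] := fun g => h20 (TR hf [0,1,3,4,2] [0,3,1,2,4] h16 g (by decide +kernel))
  have h23 : ¬le f [14,17] [12,18,19] := fun g => (fun g' : le f [14,17] [12,19] => AN hf [2,1,0,4,3] g' g' (by decide +kernel)) (GB hf [0,4,2,3,1] [0,4,2,3,1] [1,4,2,3,0] h3 g g (by decide +kernel))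
  have h24 : f [14,17] [12,18,19] ≠ [14,17] := fun g => h23 (MR hf [0,1,2,3,4] g (by decide +kernel))
  have h25 : ¬le f [12,18,30] [25,29] := fun g => h20 (TR hf [0,1,2,3,4] [0,1,2,3,4] h16 g (by decide +kernel))
  have h26 : ¬le f [12,18,30] [13,18] := fun g => h25 (TR hf [0,1,2,3,4] [1,2,0,3,4] g h (by decide +kernel))
  have h27 : f [14,17] [12,19] ≠ [12,17,29] := fun g => h26 (ML hf [1,0,2,3,4] g (by decide +kernel))
  have h28 : f [14,17] [12,19] = [12,17] := by
    rcases b6 hf with g | g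
    · exact g
    · exact absurd g h27
  have h29 : ¬le f [12,18] [11,20] := fun g => (fun g' : le f [12,18] [10,20] => AN hf [0,1,2,4,3] g' g' (by decide +kernel)) (GB hf [1,0,2,4,3] [1,2,0,3,4] [1,0,2,4,3] h28 g g (by decide +kernel))
  have h30 : ¬le f [12,18,30] [11,20] := fun g => h25 (TR hf [0,2,1,4,3] [1,2,0,4,3] g h (by decide +kernel))
  have h31 : f [14,17] [12,18,19] ≠ [12,17,29] := fun g => h26 (ML hf [1,0,2,3,4] g (by decide +kernel))
  have h32 : f [14,17] [12,18,19] = [12,17] := by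
    rcases b7 hf with g | g | g | g | g | g | g | g
    · exact g
    · exact absurd g h31
    · exact absurd g h1
    · exact absurd g h24
    · exact absurd g h8
    · exact absurd g h9
    · exact absurd g h12
    · exact absurd g h13
  have h33 : le f [12,18] [13,18] := ML hf [1,0,2,3,4] h32 (by decide +kernel)
  have h34 : le f [12,18] [25,29] := TR hf [0,1,2,3,4] [1,2,0,3,4] h33 h (by decide +kernel)
  have h35 : f [28,30] [28,29] ≠ [3,28] := fun g => h29 (GB hf [2,4,0,1,3] [2,0,1,3,4] [2,1,0,4,3] g h34 h34 (by decide +kernel))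
  have h36 : f [28,30] [28,29] = [28] := by
    rcases b8 hf with g | g
    · exact absurd g h35
    · exact g
  have h37 : le f [28] [28,30] := ML hf [0,1,2,3,4] h36 (by decide +kernel)
  have h38 : ¬le f [30] [25] := fun g => h20 (TR hf [0,1,2,3,4] [1,2,0,3,4] g h37 (by decide +kernel))
  have h39 : f [28] [19] ≠ [15] := fun g => h38 (ML hf [1,2,3,4,0] g (by decide +kernel))
  have h40 : ¬le f [12,18,30] [10,20] := fun g => h30 (TR hf [0,1,2,3,4] [0,2,1,3,4] g h33 (by decide +kernel))
  have h41 : f [12,18] [10,20] ≠ [6,24,30] := fun g => h40 (ML hf [0,1,4,2,3] g (by decide +kernel))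
  have h42 : ¬le f [30] [12,18] := fun g => h21 (TR hf [0,1,2,3,4] [0,1,2,3,4] g h33 (by decide +kernel))
  have h43 : f [12,18] [10,20] ≠ [30] := fun g => h42 (ML hf [0,1,2,3,4] g (by decide +kernel))
  have h44 : f [12,18] [10,20] = [] := by
    rcases b9 hf with g | g | g | g
    · exact g
    · exact absurd g h41
    · exact absurd g h0
    · exact absurd g h43
  have h45 : le f [] [12,18] := ML hf [0,1,2,3,4] h44 (by decide +kernel)
  have h46 : ¬le f [12,18] [] := fun g => (fun g' : le f [12,18] [12,17] => AN hf [1,0,2,3,4] g' g' (by decide +kernel)) (TR hf [0,1,2,3,4] [1,0,2,3,4] g h45 (by decide +kernel))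
  have h47 : le f [12,18] [25] := GB hf [1,2,0,3,4] [2,0,1,3,4] [2,1,0,4,3] h36 h34 h34 (by decide +kernel)
  have h48 : f [28] [19] ≠ [3,12] := fun g => (fun g' : le f [12,18] [10,20] => AN hf [0,1,2,4,3] g' g' (by decide +kernel)) (GB hf [1,3,2,4,0] [4,0,1,2,3] [4,2,3,0,1] g h47 h47 (by decide +kernel))
  have h49 : ¬le f [12,18,30] [19] := fun g => h22 (TR hf [0,1,2,3,4] [2,3,0,1,4] g h37 (by decide +kernel))
  have h50 : f [28] [19] ≠ [3,12,15] := fun g => h49 (ML hf [2,3,1,4,0] g (by decide +kernel))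
  have h51 : f [28] [19] = [] := by
    rcases b10 hf with g | g | g | g
    · exact g
    · exact absurd g h48
    · exact absurd g h50
    · exact absurd g h39
  exact h46 (GB hf [1,2,3,4,0] [4,0,1,2,3] [4,2,3,0,1] h51 h47 h47 (by decide +kernel))

theorem l3 (hf : Op5 f) : ¬le f [24,28,30] [12,18,30] := by
  intro h
  have h0 : f [12,18,30] [10,20,30] ≠ [6,24,30] := fun g => (fun g' : le f [12,18,30] [10,20,30] => AN hf [0,1,2,4,3] g' g' (by decide +kernel)) (ML hf [0,1,4,2,3] g (by decide +kernel))
  have h1 : f [12,18,30] [10,20,30] = [30] := by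
    rcases b1 hf with g | g
    · exact g
    · exact absurd g h0
  have h2 : le f [24,28,30] [30] := GB hf [0,1,2,3,4] [0,1,2,3,4] [0,1,2,4,3] h1 h h (by decide +kernel)
  have h3 : ¬le f [30] [24,28,30] := fun g => (fun g' : le f [24,28,30] [24,26,30] => AN hf [0,2,1,3,4] g' g' (by decide +kernel)) (TR hf [0,1,2,3,4] [0,2,1,3,4] h2 g (by decide +kernel))
  have h4 : ¬le f [12,18,30] [18,26,30] := fun g => (fun g' : le f [24,28,30] [20,28,30] => AN hf [0,1,3,2,4] g' g' (by decide +kernel)) (TR hf [0,1,2,4,3] [0,2,1,3,4] h g (by decide +kernel))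
  have h5 : f [24,28,30] [24,26,30] ≠ [6,24,30] := fun g => h4 (ML hf [0,2,3,1,4] g (by decide +kernel))
  have h6 : f [24,28,30] [24,26,30] = [24,30] := by
    rcases b2 hf with g | g
    · exact g
    · exact absurd g h5
  have h7 : le f [24,30] [24,28,30] := ML hf [0,1,2,3,4] h6 (by decide +kernel)
  have h8 : ¬le f [12,18,30] [18,30] := fun g => h4 (TR hf [0,1,2,3,4] [0,2,3,1,4] g h7 (by decide +kernel))
  have h9 : f [24,30] [6,30] ≠ [6,24,30] := fun g => h8 (ML hf [0,2,3,1,4] g (by decide +kernel))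
  have h10 : f [24,30] [6,30] = [30] := by
    rcases b4 hf with g | g
    · exact g
    · exact absurd g h9
  have h11 : ¬le f [30] [24,30] := fun g => h3 (TR hf [0,1,2,3,4] [0,1,2,3,4] g h7 (by decide +kernel))
  exact h11 (ML hf [0,1,2,3,4] h10 (by decide +kernel))

theorem l4 (hf : Op5 f) : ¬le f [24,28] [20,28,30] := by
  intro h
  have h0 : f [24,28] [20,28] ≠ [12,28] := fun g => (fun g' : le f [24,28] [20,28] => AN hf [0,1,3,2,4] g' g' (by decide +kernel)) (ML hf [0,1,3,4,2] g (by decide +kernel))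
  have h1 : f [24,28,30] [20,28,30] ≠ [12,28,30] := fun g => (fun g' : le f [24,28,30] [20,28,30] => AN hf [0,1,3,2,4] g' g' (by decide +kernel)) (ML hf [0,1,3,4,2] g (by decide +kernel))
  have h2 : f [24,28,30] [20,28,30] = [28,30] := by
    rcases b0 hf with g | g
    · exact g
    · exact absurd g h1
  have h3 : le f [28,30] [24,28,30] := ML hf [0,1,2,3,4] h2 (by decide +kernel)
  have h4 : f [14,17] [12,18,19] ≠ [12,19] := fun g => (fun g' : le f [14,17] [12,19] => AN hf [2,1,0,4,3] g' g' (by decide +kernel)) (ML hf [2,1,0,4,3] g (by decide +kernel))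
  have h5 : ¬le f [12,18,19] [10,17,21] := fun g => (fun g' : le f [12,18,19] [9,11,20] => AN hf [1,0,2,4,3] g' g' (by decide +kernel)) (TR hf [0,1,3,2,4] [3,4,1,2,0] g g (by decide +kernel))
  have h6 : ¬le f [12,18,19] [12,14,17] := fun g => h5 (TR hf [0,1,2,3,4] [1,2,0,4,3] g g (by decide +kernel))
  have h7 : f [14,17] [12,18,19] ≠ [12,17,19] := fun g => (fun g' : le f [12,18,19] [12,17,19] => AN hf [1,0,2,3,4] g' g' (by decide +kernel)) (MR hf [1,0,2,3,4] g (by decide +kernel))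
  have h8 : ¬le f [12,18,19] [9,20,22] := fun g => (fun g' : le f [12,18,19] [9,11,20] => AN hf [1,0,2,4,3] g' g' (by decide +kernel)) (TR hf [0,4,3,2,1] [4,1,0,2,3] g g (by decide +kernel))
  have h9 : ¬le f [12,18,19] [9,13,18] := fun g => h8 (TR hf [0,1,2,3,4] [2,0,1,4,3] g g (by decide +kernel))
  have h10 : f [14,17] [12,18,19] ≠ [12,14,17] := fun g => h9 (MR hf [2,0,1,4,3] g (by decide +kernel))
  have h11 : f [14,17] [12,18,19] ≠ [3,12,19] := fun g => (fun g' : le f [12,18,19] [12,17,19] => AN hf [1,0,2,3,4] g' g' (by decide +kernel)) (MR hf [1,4,2,3,0] g (by decide +kernel))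
  have h12 : f [24,28,30] [24,28,29] ≠ [24,28] := fun g => (fun g' : le f [24,28] [20,28] => AN hf [0,1,3,2,4] g' g' (by decide +kernel)) (GB hf [0,1,3,2,4] [0,1,3,2,4] [1,0,3,2,4] g h h (by decide +kernel))
  have h13 : f [24,28,30] [24,28,29] = [3,24,28] := by
    rcases b11 hf with g | g
    · exact g
    · exact absurd g h12
  have h14 : le f [12,18,19] [18,19,27] := ML hf [2,3,0,1,4] h13 (by decide +kernel)
  have h15 : f [12,18,30] [10,20,30] ≠ [6,24,30] := fun g => (fun g' : le f [12,18,30] [10,20,30] => AN hf [0,1,2,4,3] g' g' (by decide +kernel)) (ML hf [0,1,4,2,3] g (by decide +kernel))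
  have h16 : f [12,18,30] [10,20,30] = [30] := by
    rcases b1 hf with g | g
    · exact g
    · exact absurd g h15
  have h17 : le f [30] [12,18,30] := ML hf [0,1,2,3,4] h16 (by decide +kernel)
  have h18 : ¬le f [12,18,30] [17,19,27] := fun g => (l0 hf) (TR hf [0,1,3,4,2] [0,3,1,2,4] h17 g (by decide +kernel))
  have h19 : f [12,18,19] [12,17,19] ≠ [3,12,19] := fun g => (fun g' : le f [12,18,19] [12,17,19] => AN hf [1,0,2,3,4] g' g' (by decide +kernel)) (ML hf [1,4,2,3,0] g (by decide +kernel))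
  have h20 : f [12,18,19] [12,17,19] = [12,19] := by
    rcases b5 hf with g | g
    · exact g
    · exact absurd g h19
  have h21 : ¬le f [12,18,19] [17,19,27] := fun g => (fun g' : le f [12,18,19] [12,17,19] => AN hf [1,0,2,3,4] g' g' (by decide +kernel)) (GB hf [2,3,1,0,4] [3,2,0,1,4] [3,2,1,0,4] h13 g g (by decide +kernel))
  have h22 : le f [24,28] [28,30] := GB hf [0,1,3,4,2] [0,1,4,2,3] [0,1,4,3,2] h2 h h (by decide +kernel)
  have h23 : le f [24,28] [24,28,30] := TR hf [0,1,2,3,4] [0,1,2,3,4] h22 h3 (by decide +kernel)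
  have h24 : ¬le f [12,18,19] [17,19] := fun g => h21 (TR hf [0,1,2,3,4] [2,3,1,0,4] g h23 (by decide +kernel))
  have h25 : f [24,28] [20,28] ≠ [3,12,28] := fun g => h24 (ML hf [2,3,1,4,0] g (by decide +kernel))
  have h26 : le f [24,28] [3,20,28] := GB hf [0,1,3,2,4] [0,1,3,2,4] [1,0,3,2,4] h13 h h (by decide +kernel)
  have h27 : le f [24,28] [3,28] := GB hf [3,4,0,1,2] [2,3,4,0,1] [2,3,4,1,0] h20 h26 h26 (by decide +kernel)
  have h28 : ¬le f [12,18,30] [12,17,19] := fun g => h18 (TR hf [0,1,2,3,4] [1,0,2,3,4] g h14 (by decide +kernel))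
  have h29 : f [14,17] [12,18,19] ≠ [12,17,29] := fun g => h28 (MR hf [1,0,2,3,4] g (by decide +kernel))
  have h30 : ¬le f [14,17] [12,18,19] := fun g => (fun g' : le f [14,17] [12,19] => AN hf [2,1,0,4,3] g' g' (by decide +kernel)) (GB hf [0,4,2,3,1] [0,4,2,3,1] [1,4,2,3,0] h20 g g (by decide +kernel))
  have h31 : f [14,17] [12,18,19] ≠ [14,17] := fun g => h30 (MR hf [0,1,2,3,4] g (by decide +kernel))
  have h32 : le f [14,17] [12,14,17] := ML hf [1,2,0,4,3] h20 (by decide +kernel)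
  have h33 : le f [14,17] [12,14,30] := TR hf [0,1,2,3,4] [1,2,0,4,3] h32 h14 (by decide +kernel)
  have h34 : ¬le f [12,18,30] [13,18] := fun g => h18 (TR hf [0,2,1,4,3] [2,1,0,4,3] g h33 (by decide +kernel))
  have h35 : f [14,17] [12,19] ≠ [12,17,29] := fun g => h34 (ML hf [1,0,2,3,4] g (by decide +kernel))
  have h36 : f [14,17] [12,19] = [12,17] := by
    rcases b6 hf with g | g
    · exact g
    · exact absurd g h35
  have h37 : ¬le f [12,18] [11,20] := fun g => (fun g' : le f [12,18] [10,20] => AN hf [0,1,2,4,3] g' g' (by decide +kernel)) (GB hf [1,0,2,4,3] [1,2,0,3,4] [1,0,2,4,3] h36 g g (by decide +kernel))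
  have h38 : ¬le f [12,18] [10,17,21] := fun g => h37 (GB hf [1,3,2,4,0] [4,2,0,3,1] [4,3,1,2,0] h20 g g (by decide +kernel))
  have h39 : ¬le f [14,17] [12,14] := fun g => AN hf [0,4,1,2,3] g h27 (by decide +kernel)
  have h40 : f [24,28] [20,28] ≠ [3,28] := fun g => h39 (ML hf [0,4,1,2,3] g (by decide +kernel))
  have h41 : f [24,28] [20,28] = [28] := by
    rcases b12 hf with g | g | g | g
    · exact absurd g h40
    · exact absurd g h25
    · exact absurd g h0
    · exact g
  have h42 : le f [28] [24,28] := ML hf [0,1,2,3,4] h41 (by decide +kernel)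
  have h43 : ¬le f [12,18] [24,25] := fun g => h37 (TR hf [0,2,4,1,3] [2,4,0,1,3] g h27 (by decide +kernel))
  have h44 : ¬le f [12,18,19] [14,17] := fun g => h6 (TR hf [0,1,2,3,4] [0,1,2,3,4] g h32 (by decide +kernel))
  have h45 : f [14,17] [12,18,19] ≠ [12,18,19] := fun g => h44 (ML hf [0,1,2,3,4] g (by decide +kernel))
  have h46 : f [14,17] [12,18,19] = [12,17] := by
    rcases b7 hf with g | g | g | g | g | g | g | g
    · exact g
    · exact absurd g h29
    · exact absurd g h4
    · exact absurd g h31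
    · exact absurd g h45
    · exact absurd g h7
    · exact absurd g h10
    · exact absurd g h11
  have h47 : le f [12,18] [12,17,19] := MR hf [1,0,2,3,4] h46 (by decide +kernel)
  have h48 : ¬le f [12,18] [25] := fun g => h43 (TR hf [0,1,2,3,4] [1,2,0,3,4] g h42 (by decide +kernel))
  have h49 : le f [12,18] [13,18] := ML hf [1,0,2,3,4] h46 (by decide +kernel)
  have h50 : le f [12,18] [17,19,27] := TR hf [0,2,1,4,3] [2,1,0,4,3] h49 h33 (by decide +kernel)
  have h51 : f [24,28,30] [18,19,27] ≠ [10,26] := fun g => h43 (GB hf [1,4,2,3,0] [4,2,0,1,3] [4,0,2,3,1] g h50 h50 (by decide +kernel))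
  have h52 : f [24,28,30] [18,19,27] ≠ [26] := fun g => h48 (GB hf [1,4,2,3,0] [4,2,0,1,3] [4,0,2,3,1] g h50 h50 (by decide +kernel))
  have h53 : f [24,28,30] [18,19,27] ≠ [5,26] := fun g => h37 (GB hf [2,3,4,1,0] [4,2,0,1,3] [4,0,2,3,1] g h50 h50 (by decide +kernel))
  have h54 : f [24,28,30] [18,19,27] = [5,10,26] := by
    rcases b13 hf with g | g | g | g
    · exact absurd g h52
    · exact g
    · exact absurd g h53
    · exact absurd g h51
  have h55 : le f [12,18,19] [17,25,27] := ML hf [2,1,3,4,0] h54 (by decide +kernel)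
  have h56 : le f [12,18] [17,25,27] := TR hf [0,4,2,3,1] [4,1,2,3,0] h47 h55 (by decide +kernel)
  have h57 : ¬le f [12,18] [17,25,29] := fun g => h38 (GB hf [1,3,2,0,4] [3,0,1,2,4] [3,0,1,2,4] h13 g h56 (by decide +kernel))
  have h58 : le f [12,18] [10,20,21] := GB hf [1,4,3,2,0] [4,2,0,1,3] [4,0,2,3,1] h54 h50 h50 (by decide +kernel)
  exact h57 (TR hf [0,1,2,3,4] [0,2,1,3,4] h58 h55 (by decide +kernel))

theorem l5 (hf : Op5 f) : ¬le f [24,30] [20,28,30] := by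
  intro h
  have h0 : f [24,28,30] [6,22,30] ≠ [10,30] := fun g => (fun g' : le f [24,30] [6,30] => AN hf [0,3,4,1,2] g' g' (by decide +kernel)) (GB hf [0,1,3,2,4] [0,1,3,2,4] [0,3,1,4,2] g h h (by decide +kernel))
  have h1 : f [12,18,30] [10,20,30] ≠ [6,24,30] := fun g => (fun g' : le f [12,18,30] [10,20,30] => AN hf [0,1,2,4,3] g' g' (by decide +kernel)) (ML hf [0,1,4,2,3] g (by decide +kernel))
  have h2 : f [12,18,30] [10,20,30] = [30] := by
    rcases b1 hf with g | g
    · exact g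
    · exact absurd g h1
  have h3 : f [24,28,30] [6,22,30] ≠ [10,20,30] := fun g => (l1 hf) (ML hf [0,1,2,4,3] g (by decide +kernel))
  have h4 : f [24,28,30] [6,22,30] ≠ [12,18,30] := fun g => (l1 hf) (ML hf [0,1,2,3,4] g (by decide +kernel))
  have h5 : f [24,28] [20,28] ≠ [12,28] := fun g => (fun g' : le f [24,28] [20,28] => AN hf [0,1,3,2,4] g' g' (by decide +kernel)) (ML hf [0,1,3,4,2] g (by decide +kernel))
  have h6 : ¬le f [24,28] [20,30] := fun g => (l4 hf) (TR hf [0,1,2,4,3] [0,1,4,3,2] g h (by decide +kernel))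
  have h7 : f [24,30] [20,29] ≠ [12,28] := fun g => h6 (ML hf [0,1,3,4,2] g (by decide +kernel))
  have h8 : ¬le f [30] [24,29] := fun g => (l0 hf) (TR hf [0,1,2,3,4] [1,2,0,3,4] g h (by decide +kernel))
  have h9 : ¬le f [24,28] [24,30] := fun g => (l4 hf) (TR hf [0,1,2,3,4] [0,1,2,3,4] g h (by decide +kernel))
  have h10 : f [24,30] [24,28] ≠ [24,28] := fun g => h9 (ML hf [0,1,2,3,4] g (by decide +kernel))
  have h11 : f [24,28,30] [20,28,30] ≠ [12,28,30] := fun g => (fun g' : le f [24,28,30] [20,28,30] => AN hf [0,1,3,2,4] g' g' (by decide +kernel)) (ML hf [0,1,3,4,2] g (by decide +kernel))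
  have h12 : f [24,28,30] [20,28,30] = [28,30] := by
    rcases b0 hf with g | g
    · exact g
    · exact absurd g h11
  have h13 : ¬le f [14,17] [24,28,30] := fun g => (l2 hf) (GB hf [0,1,2,3,4] [0,1,2,3,4] [0,1,3,2,4] h12 g g (by decide +kernel))
  have h14 : f [12,18,19] [12,17,19] ≠ [3,12,19] := fun g => (fun g' : le f [12,18,19] [12,17,19] => AN hf [1,0,2,3,4] g' g' (by decide +kernel)) (ML hf [1,4,2,3,0] g (by decide +kernel))
  have h15 : f [12,18,19] [12,17,19] = [12,19] := by
    rcases b5 hf with g | g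
    · exact g
    · exact absurd g h14
  have h16 : le f [14,17] [12,14,17] := ML hf [1,2,0,4,3] h15 (by decide +kernel)
  have h17 : ¬le f [12,18,19] [24,26,27] := fun g => h13 (TR hf [0,1,2,3,4] [1,2,0,4,3] h16 g (by decide +kernel))
  have h18 : ¬le f [12,18,19] [18,27] := fun g => h17 (TR hf [0,1,2,3,4] [2,0,3,1,4] g h (by decide +kernel))
  have h19 : f [24,30] [24,28] ≠ [3,24,28] := fun g => h18 (ML hf [2,3,0,1,4] g (by decide +kernel))
  have h20 : ¬le f [24,28,30] [18,26,30] := fun g => (fun g' : le f [24,28,30] [6,22,30] => AN hf [0,3,4,1,2] g' g' (by decide +kernel)) (TR hf [0,1,2,3,4] [0,2,3,4,1] g g (by decide +kernel))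
  have h21 : ¬le f [24,28,30] [24,30] := fun g => h20 (TR hf [0,1,2,3,4] [0,2,1,3,4] g h (by decide +kernel))
  have h22 : f [24,30] [24,28] ≠ [24,26,30] := fun g => h21 (ML hf [0,2,1,3,4] g (by decide +kernel))
  have h23 : ¬le f [24,28,30] [24,29] := fun g => (fun g' : le f [24,30] [20,29] => AN hf [1,0,3,2,4] g' g' (by decide +kernel)) (TR hf [0,1,2,3,4] [0,1,3,2,4] h g (by decide +kernel))
  have h24 : f [24,30] [24,28] ≠ [24,28,29] := fun g => h23 (ML hf [1,0,2,3,4] g (by decide +kernel))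
  have h25 : ¬le f [12,18,30] [18,30] := fun g => (l1 hf) (TR hf [0,2,1,4,3] [0,1,4,2,3] g h (by decide +kernel))
  have h26 : f [24,30] [6,30] ≠ [6,24,30] := fun g => h25 (ML hf [0,2,3,1,4] g (by decide +kernel))
  have h27 : f [24,30] [6,30] = [30] := by
    rcases b4 hf with g | g
    · exact g
    · exact absurd g h26
  have h28 : le f [30] [24,30] := ML hf [0,1,2,3,4] h27 (by decide +kernel)
  have h29 : ¬le f [24,30] [30] := fun g => AN hf [0,1,2,3,4] g h28 (by decide +kernel)
  have h30 : ¬le f [24,30] [12,18,30] := fun g => h29 (GB hf [0,1,2,3,4] [0,1,2,3,4] [0,1,2,4,3] h2 g g (by decide +kernel))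
  have h31 : f [24,28,30] [6,22,30] ≠ [6,24,30] := fun g => h30 (GB hf [0,1,4,2,3] [0,1,3,2,4] [0,3,1,4,2] g h h (by decide +kernel))
  have h32 : le f [24,30] [28,30] := GB hf [0,1,3,4,2] [0,1,4,2,3] [0,1,4,3,2] h12 h h (by decide +kernel)
  have h33 : le f [28,30] [24,28,30] := ML hf [0,1,2,3,4] h12 (by decide +kernel)
  have h34 : le f [24,30] [24,28,30] := TR hf [0,1,2,3,4] [0,1,2,3,4] h32 h33 (by decide +kernel)
  have h35 : ¬le f [12,18,19] [9,25,27] := fun g => h13 (TR hf [0,3,1,2,4] [3,1,0,4,2] h16 g (by decide +kernel))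
  have h36 : ¬le f [12,18,19] [17,27] := fun g => h35 (TR hf [0,1,2,3,4] [2,1,3,4,0] g h (by decide +kernel))
  have h37 : f [24,30] [20,29] ≠ [3,12,28] := fun g => h36 (ML hf [2,3,1,4,0] g (by decide +kernel))
  have h38 : ¬le f [14,17] [12,30] := fun g => h13 (TR hf [0,1,2,3,4] [0,1,4,2,3] g h (by decide +kernel))
  have h39 : f [24,30] [20,29] ≠ [3,28] := fun g => h38 (ML hf [0,4,1,2,3] g (by decide +kernel))
  have h40 : f [24,30] [20,29] = [28] := by
    rcases b14 hf with g | g | g | g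
    · exact g
    · exact absurd g h7
    · exact absurd g h37
    · exact absurd g h39
  have h41 : le f [28] [24,30] := ML hf [0,1,2,3,4] h40 (by decide +kernel)
  have h42 : ¬le f [30] [28] := fun g => h8 (TR hf [0,1,2,3,4] [1,0,2,3,4] g h41 (by decide +kernel))
  have h43 : f [24,30] [24,28] ≠ [6,24,30] := fun g => h25 (ML hf [0,2,3,1,4] g (by decide +kernel))
  have h44 : f [24,30] [24,28] ≠ [24,28,30] := fun g => h21 (ML hf [0,1,2,3,4] g (by decide +kernel))
  have h45 : f [24,30] [24,28] = [24,30] := by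
    rcases b15 hf with g | g | g | g | g | g | g
    · exact g
    · exact absurd g h10
    · exact absurd g h19
    · exact absurd g h43
    · exact absurd g h44
    · exact absurd g h22
    · exact absurd g h24
  have h46 : le f [24,30] [24,28] := MR hf [0,1,2,3,4] h45 (by decide +kernel)
  have h47 : le f [30] [24,28] := TR hf [0,1,2,3,4] [0,1,2,3,4] h28 h46 (by decide +kernel)
  have h48 : f [24,28] [20,28] ≠ [28] := fun g => h42 (GB hf [0,1,2,3,4] [0,1,2,3,4] [0,1,3,2,4] g h47 h47 (by decide +kernel))
  have h49 : le f [28] [24,26] := TR hf [0,1,2,3,4] [0,2,1,3,4] h41 h46 (by decide +kernel)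
  have h50 : f [24,28,30] [6,22,30] ≠ [30] := fun g => h29 (GB hf [0,1,3,2,4] [0,1,3,2,4] [0,3,1,4,2] g h h (by decide +kernel))
  have h51 : f [24,28,30] [6,22,30] = [20,30] := by
    rcases b16 hf with g | g | g | g | g | g
    · exact absurd g h50
    · exact absurd g h0
    · exact g
    · exact absurd g h31
    · exact absurd g h3
    · exact absurd g h4
  have h52 : le f [28] [18,26,30] := TR hf [0,1,2,3,4] [0,2,1,3,4] h41 h (by decide +kernel)
  have h53 : le f [28] [24,26,30] := TR hf [0,1,2,3,4] [0,2,1,3,4] h41 h34 (by decide +kernel)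
  have h54 : le f [28] [18,30] := GB hf [0,2,1,3,4] [0,2,1,3,4] [0,2,3,4,1] h51 h53 h52 (by decide +kernel)
  have h55 : le f [28] [18,26] := TR hf [0,1,2,3,4] [0,2,3,1,4] h54 h46 (by decide +kernel)
  have h56 : ¬le f [28] [24,27] := fun g => (fun g' : le f [28] [26] => AN hf [0,2,1,3,4] g' g' (by decide +kernel)) (GB hf [2,0,1,3,4] [1,2,0,3,4] [1,2,0,3,4] h40 g h54 (by decide +kernel))
  have h57 : ¬le f [28] [18,26,27] := fun g => h56 (GB hf [2,0,3,1,4] [1,3,0,2,4] [3,1,0,4,2] h51 g g (by decide +kernel))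
  have h58 : ¬le f [24,28] [24,28,30] := fun g => h57 (TR hf [0,1,2,3,4] [2,0,3,1,4] h55 g (by decide +kernel))
  have h59 : f [24,28,30] [24,28,29] ≠ [24,28] := fun g => h58 (ML hf [0,1,2,3,4] g (by decide +kernel))
  have h60 : f [24,28,30] [24,28,29] = [3,24,28] := by
    rcases b11 hf with g | g
    · exact g
    · exact absurd g h59
  have h61 : le f [12,18,19] [18,19,27] := ML hf [2,3,0,1,4] h60 (by decide +kernel)
  have h62 : ¬le f [28] [10,17,21] := fun g => h57 (TR hf [1,0,3,2,4] [3,1,2,0,4] g h61 (by decide +kernel))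
  have h63 : f [24,28] [20,28] ≠ [3,12,28] := fun g => h62 (GB hf [1,3,0,4,2] [0,2,1,3,4] [0,2,1,3,4] g h49 h55 (by decide +kernel))
  have h64 : f [24,28] [20,28] = [3,28] := by
    rcases b12 hf with g | g | g | g
    · exact g
    · exact absurd g h63
    · exact absurd g h5
    · exact absurd g h48
  have h65 : le f [14,17] [12,14,30] := TR hf [0,1,2,3,4] [1,2,0,4,3] h16 h61 (by decide +kernel)
  have h66 : ¬le f [28] [14,17] := fun g => h57 (TR hf [0,1,3,4,2] [2,3,1,4,0] g h65 (by decide +kernel))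
  exact h66 (GB hf [0,4,2,3,1] [0,4,1,2,3] [0,4,1,3,2] h64 h55 h55 (by decide +kernel))

theorem l6 (hf : Op5 f) : False := by
  have h0 : f [24,28,30] [12,18,30] ≠ [12,30] := fun g => (l5 hf) (ML hf [0,1,3,4,2] g (by decide +kernel))
  have h1 : f [24,28,30] [12,18,30] ≠ [20,28,30] := fun g => (fun g' : le f [24,28,30] [20,28,30] => AN hf [0,1,3,2,4] g' g' (by decide +kernel)) (ML hf [0,1,3,2,4] g (by decide +kernel))
  have h2 : f [24,28,30] [12,18,30] ≠ [12,18,30] := fun g => (l1 hf) (ML hf [0,1,2,3,4] g (by decide +kernel))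
  have h3 : f [24,28,30] [12,18,30] ≠ [12,28,30] := fun g => (fun g' : le f [24,28,30] [20,28,30] => AN hf [0,1,3,2,4] g' g' (by decide +kernel)) (ML hf [0,1,3,4,2] g (by decide +kernel))
  have h4 : f [24,28,30] [12,18,30] ≠ [24,28,30] := fun g => (l3 hf) (MR hf [0,1,2,3,4] g (by decide +kernel))
  have h5 : f [24,28,30] [20,22,30] ≠ [20,30] := fun g => (l5 hf) (ML hf [0,1,3,2,4] g (by decide +kernel))
  have h6 : ¬le f [24,28,30] [20,22,30] := fun g => (fun g' : le f [24,28,30] [6,22,30] => AN hf [0,3,4,1,2] g' g' (by decide +kernel)) (TR hf [0,1,2,4,3] [0,4,1,3,2] g g (by decide +kernel))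
  have h7 : f [24,28,30] [20,22,30] ≠ [24,28,30] := fun g => h6 (MR hf [0,1,2,3,4] g (by decide +kernel))
  have h8 : f [24,28,30] [20,22,30] ≠ [20,28,30] := fun g => (fun g' : le f [24,28,30] [20,28,30] => AN hf [0,1,3,2,4] g' g' (by decide +kernel)) (ML hf [0,1,3,2,4] g (by decide +kernel))
  have h9 : ¬le f [24,28,30] [18,26,30] := fun g => (fun g' : le f [24,28,30] [6,22,30] => AN hf [0,3,4,1,2] g' g' (by decide +kernel)) (TR hf [0,1,2,3,4] [0,2,3,4,1] g g (by decide +kernel))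
  have h10 : f [24,28,30] [20,22,30] ≠ [20,22,30] := fun g => h9 (ML hf [0,2,3,1,4] g (by decide +kernel))
  have h11 : f [24,28,30] [20,22,30] ≠ [12,28,30] := fun g => (fun g' : le f [24,28,30] [20,28,30] => AN hf [0,1,3,2,4] g' g' (by decide +kernel)) (ML hf [0,1,3,4,2] g (by decide +kernel))
  have h12 : f [24,28,30] [20,22,30] ≠ [10,20,30] := fun g => (l1 hf) (ML hf [0,1,2,4,3] g (by decide +kernel))
  have h13 : f [24,28,30] [20,22,30] = [28,30] := by
    rcases b17 hf with g | g | g | g | g | g | g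
    · exact g
    · exact absurd g h5
    · exact absurd g h7
    · exact absurd g h8
    · exact absurd g h10
    · exact absurd g h11
    · exact absurd g h12
  have h14 : le f [28,30] [24,26,30] := MR hf [0,1,3,2,4] h13 (by decide +kernel)
  have h15 : f [24,28,30] [12,18,30] ≠ [12,14,30] := fun g => h9 (ML hf [0,2,3,4,1] g (by decide +kernel))
  have h16 : f [24,28,30] [12,18,30] = [28,30] := by
    rcases b3 hf with g | g | g | g | g | g | g
    · exact g
    · exact absurd g h0
    · exact absurd g h1
    · exact absurd g h2
    · exact absurd g h3
    · exact absurd g h4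
    · exact absurd g h15
  have h17 : ¬le f [28,30] [12,18,30] := fun g => (fun g' : le f [28,30] [26,30] => AN hf [0,2,1,3,4] g' g' (by decide +kernel)) (GB hf [0,2,1,3,4] [0,2,1,3,4] [0,2,1,4,3] h16 h14 g (by decide +kernel))
  exact h17 (MR hf [0,1,2,3,4] h16 (by decide +kernel))

/-- For any finite taxon set `X` with at least 5 elements, there is no
binary consensus function `φ : RP(X)² → RP(X)` that is idempotent, commutative,
associative, neutral, and Pareto on rooted triples. -/
theorem no_idempotent_commutative_associative_neutral_pareto_op
    (X : Set α) (hXfin : X.Finite) (hX5 : 5 ≤ X.ncard) :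
    ¬ ∃ φ : Set (Set α) → Set (Set α) → Set (Set α),
      -- `φ` maps pairs of trees on `X` to trees on `X`
      (∀ T₁ ∈ RP X, ∀ T₂ ∈ RP X, φ T₁ T₂ ∈ RP X) ∧
      -- idempotent
      (∀ T ∈ RP X, φ T T = T) ∧
      -- commutative
      (∀ T₁ ∈ RP X, ∀ T₂ ∈ RP X, φ T₁ T₂ = φ T₂ T₁) ∧
      -- associative
      (∀ T₁ ∈ RP X, ∀ T₂ ∈ RP X, ∀ T₃ ∈ RP X,
        φ (φ T₁ T₂) T₃ = φ T₁ (φ T₂ T₃)) ∧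
      -- neutral
      (∀ σ : α → α, Set.BijOn σ X X → ∀ T₁ ∈ RP X, ∀ T₂ ∈ RP X,
        φ (mapTree σ T₁) (mapTree σ T₂) = mapTree σ (φ T₁ T₂)) ∧
      -- Pareto on rooted triples
      (∀ W : Set α, W ⊆ X → W.ncard = 3 → ∀ T' ∈ RP W, ∀ T₁ ∈ RP X, ∀ T₂ ∈ RP X,
        T' ⊆ restrictTree W T₁ → T' ⊆ restrictTree W T₂ →
          T' ⊆ restrictTree W (φ T₁ T₂)) := by
  intro hφ
  obtain ⟨n, hn⟩ := Nat.exists_eq_add_of_le' hX5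
  obtain ⟨Y, hY, hc, φ, h⟩ := reduce_to_five n X hXfin hn hφ
  obtain ⟨f, hf⟩ := exists_op5 hY hc h
  exact l6 hf
end

section
/- Let X be a finite set, Y ⊆ X a nonempty subset with X ∖ Y = {x₁, …, x_l} enumerated, and let (φ_X^k)_{k ≥ 1} be a family of consensus functions φ_X^k : RP(X)^k → RP(X) that is regular, associatively stable, and such that each φ_X^k is Pareto on rooted triples. Define ψ_Y^k(T₁, …, T_k) := φ_X^k(T₁^X, …, T_k^X)|_Y for T₁, …, T_k ∈ RP(Y). Then the family (ψ_Y^k)_{k ≥ 1} of consensus functions on Y is regular, associatively stable, and each ψ_Y^k is Pareto on rooted triples. -/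
open Set

variable {α : Type*}

/-- A family `φ k : RP(Z)^k → RP(Z)` (`k ≥ 1`) of consensus functions on `Z` is regular
(unanimous, anonymous, neutral), associatively stable, and Pareto on rooted triples. -/
def IsRegularAssocStablePareto (Z : Set α)
    (φ : (k : ℕ) → (Fin k → Set (Set α)) → Set (Set α)) : Prop :=
  -- each `φ k` maps profiles of trees on `Z` to trees on `Z`
  (∀ k, 1 ≤ k → ∀ Ts : Fin k → Set (Set α), (∀ i, Ts i ∈ RP Z) → φ k Ts ∈ RP Z) ∧
  -- unanimity
  (∀ k, 1 ≤ k → ∀ T ∈ RP Z, φ k (fun _ => T) = T) ∧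
  -- anonymity
  (∀ k, 1 ≤ k → ∀ Ts : Fin k → Set (Set α), (∀ i, Ts i ∈ RP Z) →
    ∀ π : Equiv.Perm (Fin k), φ k (Ts ∘ π) = φ k Ts) ∧
  -- neutrality
  (∀ k, 1 ≤ k → ∀ σ : α → α, Set.BijOn σ Z Z →
    ∀ Ts : Fin k → Set (Set α), (∀ i, Ts i ∈ RP Z) →
      φ k (fun i => mapTree σ (Ts i)) = mapTree σ (φ k Ts)) ∧
  -- associative stability: `φ k (T₁, …, T_k) = φ 2 (φ (k-1) (T₁, …, T_{k-1}), T_k)` for `k ≥ 2`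
  (∀ k : ℕ, ∀ Ts : Fin (k + 2) → Set (Set α), (∀ i, Ts i ∈ RP Z) →
    φ (k + 2) Ts = φ 2 ![φ (k + 1) (Fin.init Ts), Ts (Fin.last (k + 1))]) ∧
  -- Pareto on rooted triples
  (∀ k, 1 ≤ k → ∀ W : Set α, W ⊆ Z → W.ncard = 3 → ∀ T' ∈ RP W,
    ∀ Ts : Fin k → Set (Set α), (∀ i, Ts i ∈ RP Z) →
      (∀ i, T' ⊆ restrictTree W (Ts i)) → T' ⊆ restrictTree W (φ k Ts))

/-- Given nonempty `Y ⊆ X` and an enumeration `xs = [x₁, …, x_l]` of `X ∖ Y`, the tree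
`T^X` on `X` obtained from `T ∈ RP(Y)` by attaching `x₁, …, x_l` in a caterpillar above
the root of `T`:
`T^X = T ∪ {{x₁}, …, {x_l}} ∪ {Y ∪ {x_{j+1}, …, x_l} : 0 ≤ j ≤ l}`. -/
def extendTree (Y : Set α) (xs : List α) (T : Set (Set α)) : Set (Set α) :=
  T ∪ {C | ∃ x ∈ xs, C = ({x} : Set α)} ∪
    {C | ∃ j ≤ xs.length, C = Y ∪ {a | a ∈ xs.drop j}}

/-- The consensus method on `Y` induced by a consensus method `φ` on `X ⊇ Y`:
`ψ k (T₁, …, T_k) := φ k (T₁^X, …, T_k^X)|_Y`. -/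
def inducedMethod (Y : Set α) (xs : List α)
    (φ : (k : ℕ) → (Fin k → Set (Set α)) → Set (Set α)) :
    (k : ℕ) → (Fin k → Set (Set α)) → Set (Set α) :=
  fun k Ts => restrictTree Y (φ k (fun i => extendTree Y xs (Ts i)))

theorem aux_cluster {X : Set α} (hX : X.Finite) {S : Set (Set α)} (hS : S ∈ RP X) {A : Set α}
    (hAX : A ⊆ X) (hA : A.Nonempty)
    (h : ∀ a ∈ A, ∀ b ∈ A, ∀ c ∈ X, c ∉ A → a ≠ b → ∃ C ∈ S, a ∈ C ∧ b ∈ C ∧ c ∉ C) : A ∈ S := by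
  obtain ⟨h1, h2, h3, h4⟩ := hS
  have hfin : S.Finite := hX.finite_subsets.subset (fun C hC => (h1 C hC).1)
  obtain ⟨M, hM⟩ := (hfin.subset (Set.sep_subset S (fun C => A ⊆ C))).exists_minimal ⟨X, h2, hAX⟩
  obtain ⟨⟨hMS, hAM⟩, hMmin⟩ := hM
  by_cases hMA : M ⊆ A
  · rwa [Set.Subset.antisymm hAM hMA]
  exfalso
  obtain ⟨c, hcM, hcA⟩ := Set.not_subset.1 hMA
  have hcX := (h1 M hMS).1 hcM
  obtain ⟨a, ha⟩ := hA
  have hac : c ≠ a := fun e => hcA (e ▸ ha)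
  obtain ⟨D, hD⟩ := (hfin.subset (Set.sep_subset S (fun C => a ∈ C ∧ c ∉ C))).exists_maximal
    ⟨{a}, h3 a (hAX ha), rfl, hac⟩
  obtain ⟨⟨hDS, haD, hcD⟩, hDmax⟩ := hD
  have hAD : A ⊆ D := by
    intro b hb
    by_cases hab : a = b
    · exact hab ▸ haD
    obtain ⟨C, hC, haC, hbC, hcC⟩ := h a ha b hb c hcX hcA hab
    rcases h4 C hC D hDS with e | e | e
    · exact absurd (show a ∈ C ∩ D from ⟨haC, haD⟩) (by rw [e]; exact fun h => h)
    · exact (Set.inter_eq_left.1 e) hbC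
    · exact hDmax ⟨hC, haC, hcC⟩ (Set.inter_eq_right.1 e) hbC
  rcases h4 M hMS D hDS with e | e | e
  · exact absurd (show a ∈ M ∩ D from ⟨hAM ha, haD⟩) (by rw [e]; exact fun h => h)
  · exact hcD ((Set.inter_eq_left.1 e) hcM)
  · exact hcD (hMmin ⟨hDS, hAD⟩ (Set.inter_eq_right.1 e) hcM)

theorem aux_restrict {X W : Set α} (hW : W.Nonempty) (hWX : W ⊆ X) {S : Set (Set α)}
    (hS : S ∈ RP X) : restrictTree W S ∈ RP W := by
  obtain ⟨h1, h2, h3, h4⟩ := hS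
  have hXW : X ∩ W = W := Set.inter_eq_right.2 hWX
  refine ⟨?_, ⟨X, h2, hXW.symm, by rwa [hXW]⟩, ?_, ?_⟩
  · rintro _ ⟨C, hC, rfl, hn⟩
    exact ⟨Set.inter_subset_right, hn⟩
  · intro x hx
    have : ({x} : Set α) ∩ W = {x} := Set.inter_eq_left.2 (by simpa using hx)
    exact ⟨{x}, h3 x (hWX hx), this.symm, by rw [this]; simp⟩
  · rintro _ ⟨A, hA, rfl, -⟩ _ ⟨B, hB, rfl, -⟩
    have e : A ∩ W ∩ (B ∩ W) = A ∩ B ∩ W := by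
      ext x; simp only [Set.mem_inter_iff]; tauto
    rw [e]
    rcases h4 A hA B hB with e | e | e
    · left; rw [e]; simp
    · right; left; rw [e]
    · right; right; rw [e]

theorem aux_restrict_restrict {Y W : Set α} (hWY : W ⊆ Y) (S : Set (Set α)) :
    restrictTree W (restrictTree Y S) = restrictTree W S := by
  have key : ∀ C : Set α, C ∩ Y ∩ W = C ∩ W := fun C => by
    rw [Set.inter_assoc, Set.inter_eq_right.2 hWY]
  ext D
  constructor
  · rintro ⟨_, ⟨C, hC, rfl, -⟩, rfl, hn⟩
    rw [key] at hn ⊢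
    exact ⟨C, hC, rfl, hn⟩
  · rintro ⟨C, hC, rfl, hn⟩
    exact ⟨C ∩ Y, ⟨C, hC, rfl, hn.mono (Set.inter_subset_inter_right _ hWY)⟩, (key C).symm,
      by rwa [key]⟩

theorem aux_extend {X Y : Set α} (hYX : Y ⊆ X) (hY : Y.Nonempty) {xs : List α}
    (hxs : {a | a ∈ xs} = X \ Y) {T : Set (Set α)} (hT : T ∈ RP Y) :
    extendTree Y xs T ∈ RP X := by
  obtain ⟨h1, h2, h3, h4⟩ := hT
  have hx : ∀ a, a ∈ xs ↔ a ∈ X ∧ a ∉ Y := fun a => by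
    have := Set.ext_iff.1 hxs a; simpa using this
  have hsing : ∀ (x : α) (B : Set α), {x} ∩ B = ∅ ∨ {x} ∩ B = {x} := by
    intro x B
    by_cases h : x ∈ B
    · right; simpa using h
    · left; simpa using h
  have hTsub : ∀ A ∈ T, ∀ j, A ⊆ Y ∪ {a | a ∈ xs.drop j} :=
    fun A hA j => (h1 A hA).1.trans Set.subset_union_left
  have hmono : ∀ i j, i ≤ j →
      Y ∪ {a | a ∈ xs.drop j} ⊆ Y ∪ {a | a ∈ xs.drop i} := by
    intro i j hij
    exact Set.union_subset_union_right _ (fun a ha => List.drop_subset_drop_left xs hij ha)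
  refine ⟨?_, ?_, ?_, ?_⟩
  · rintro C ((hC | ⟨x, hx', rfl⟩) | ⟨j, hj, rfl⟩)
    · exact ⟨(h1 C hC).1.trans hYX, (h1 C hC).2⟩
    · exact ⟨by simpa using ((hx x).1 hx').1, by simp⟩
    · refine ⟨Set.union_subset hYX (fun a ha => ((hx a).1 (List.mem_of_mem_drop ha)).1),
        hY.mono Set.subset_union_left⟩
  · right
    refine ⟨0, Nat.zero_le _, ?_⟩
    rw [List.drop_zero, hxs, Set.union_sdiff_cancel hYX]
  · intro x hxX
    left
    by_cases hxY : x ∈ Y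
    · exact Or.inl (h3 x hxY)
    · exact Or.inr ⟨x, (hx x).2 ⟨hxX, hxY⟩, rfl⟩
  · rintro A ((hA | ⟨x, hx', rfl⟩) | ⟨i, hi, rfl⟩) B hB
    · rcases hB with (hB | ⟨y, hy, rfl⟩) | ⟨j, hj, rfl⟩
      · exact h4 A hA B hB
      · rw [Set.inter_comm]; rcases hsing y A with h | h <;> simp [h]
      · exact Or.inr (Or.inl (Set.inter_eq_left.2 (hTsub A hA j)))
    · rcases hsing x B with h | h <;> simp [h]
    · rcases hB with (hB | ⟨y, hy, rfl⟩) | ⟨j, hj, rfl⟩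
      · exact Or.inr (Or.inr (Set.inter_eq_right.2 (hTsub B hB i)))
      · rw [Set.inter_comm]
        rcases hsing y (Y ∪ {a | a ∈ xs.drop i}) with h | h
        · exact Or.inl h
        · exact Or.inr (Or.inr h)
      · rcases le_total i j with h | h
        · exact Or.inr (Or.inr (Set.inter_eq_right.2 (hmono _ _ h)))
        · exact Or.inr (Or.inl (Set.inter_eq_left.2 (hmono _ _ h)))

theorem aux_restrict_extend {X Y : Set α} {xs : List α}
    (hxs : {a | a ∈ xs} = X \ Y) {T : Set (Set α)} (hT : T ∈ RP Y) :
    restrictTree Y (extendTree Y xs T) = T := by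
  obtain ⟨h1, h2, h3, h4⟩ := hT
  have hx : ∀ a, a ∈ xs ↔ a ∈ X ∧ a ∉ Y := fun a => by
    have := Set.ext_iff.1 hxs a; simpa using this
  ext D
  constructor
  · rintro ⟨C, (hC | ⟨x, hx', rfl⟩) | ⟨j, hj, rfl⟩, rfl, hn⟩
    · rwa [Set.inter_eq_left.2 (h1 C hC).1]
    · obtain ⟨z, rfl, hz⟩ := hn
      exact absurd hz ((hx z).1 hx').2
    · rwa [Set.inter_eq_right.2 Set.subset_union_left]
  · intro hD
    have e : D ∩ Y = D := Set.inter_eq_left.2 (h1 D hD).1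
    exact ⟨D, Or.inl (Or.inl hD), e.symm, by rw [e]; exact (h1 D hD).2⟩

theorem aux_triple (a b c : α) :
    ({{a, b, c}, {a}, {b}, {c}, {a, b}} : Set (Set α)) ∈ RP ({a, b, c} : Set α) := by
  have hsing : ∀ (x : α) (B : Set α), {x} ∩ B = ∅ ∨ {x} ∩ B = {x} := by
    intro x B
    by_cases h : x ∈ B
    · right; simpa using h
    · left; simpa using h
  have hsing' : ∀ (x : α) (B : Set α), B ∩ {x} = ∅ ∨ B ∩ {x} = {x} := by
    intro x B
    rw [Set.inter_comm]; exact hsing x B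
  have hs : ({a, b} : Set α) ⊆ {a, b, c} := by
    intro x; simp only [Set.mem_insert_iff, Set.mem_singleton_iff]; tauto
  refine ⟨?_, by simp, ?_, ?_⟩
  · rintro C (rfl | rfl | rfl | rfl | rfl) <;> constructor <;> first | exact hs | simp
  · rintro x (rfl | rfl | rfl) <;> simp
  · rintro A (rfl | rfl | rfl | rfl | rfl) B (rfl | rfl | rfl | rfl | rfl) <;>
    first
    | exact Or.inr (Or.inl (Set.inter_self _))
    | exact (hsing _ _).imp_right Or.inl
    | exact (hsing' _ _).imp_right Or.inr
    | exact Or.inr (Or.inl (Set.inter_eq_left.2 hs))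
    | exact Or.inr (Or.inr (Set.inter_eq_right.2 hs))

theorem aux_main {X Y : Set α} (hXfin : X.Finite) (hY : Y.Nonempty) (hYX : Y ⊆ X)
    {xs : List α} (hnodup : xs.Nodup) (hxs : {a | a ∈ xs} = X \ Y)
    {φ : (k : ℕ) → (Fin k → Set (Set α)) → Set (Set α)}
    (hφ : IsRegularAssocStablePareto X φ) {k : ℕ} (hk : 1 ≤ k) {Ts : Fin k → Set (Set α)}
    (hTs : ∀ i, Ts i ∈ RP Y) :
    extendTree Y xs (restrictTree Y (φ k (fun i => extendTree Y xs (Ts i)))) =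
      φ k (fun i => extendTree Y xs (Ts i)) := by
  obtain ⟨p1, -, -, -, -, p6⟩ := hφ
  have hx : ∀ a, a ∈ xs ↔ a ∈ X ∧ a ∉ Y := fun a => by
    have := Set.ext_iff.1 hxs a; simpa using this
  have hE : ∀ i, extendTree Y xs (Ts i) ∈ RP X := fun i => aux_extend hYX hY hxs (hTs i)
  have hS := p1 k hk _ hE
  have hP := fun W hW hc T' hT' => p6 k hk W hW hc T' hT' _ hE
  generalize φ k (fun i => extendTree Y xs (Ts i)) = S at hS hP
  have hYj : ∀ j ≤ xs.length, Y ∪ {a | a ∈ xs.drop j} ∈ S := by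
    intro j hj
    have hsub : Y ∪ {a | a ∈ xs.drop j} ⊆ X :=
      Set.union_subset hYX (fun a ha => ((hx a).1 (List.mem_of_mem_drop ha)).1)
    refine aux_cluster hXfin hS hsub (hY.mono Set.subset_union_left) ?_
    intro a ha b hb c hcX hc hab
    have hac : a ≠ c := fun e => hc (e ▸ ha)
    have hbc : b ≠ c := fun e => hc (e ▸ hb)
    have hWX : ({a, b, c} : Set α) ⊆ X := by
      rintro x (rfl | rfl | rfl)
      exacts [hsub ha, hsub hb, hcX]
    have := hP {a, b, c} hWX (Set.ncard_eq_three.2 ⟨a, b, c, hab, hac, hbc, rfl⟩) _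
      (aux_triple a b c) ?_
    · obtain ⟨C, hC, e, -⟩ := this (show ({a, b} : Set α) ∈ _ by simp)
      have e' := fun x => Set.ext_iff.1 e x
      refine ⟨C, hC, ((e' a).1 (by simp)).1, ((e' b).1 (by simp)).1, fun hcC => ?_⟩
      rcases (e' c).2 ⟨hcC, by simp⟩ with h | h
      · exact hac h.symm
      · exact hbc h.symm
    · intro i
      have hr := aux_restrict (W := {a, b, c}) (by simp) hWX (hE i)
      rintro C (rfl | rfl | rfl | rfl | rfl)
      · exact hr.2.1
      · exact hr.2.2.1 _ (by simp)
      · exact hr.2.2.1 _ (by simp)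
      · exact hr.2.2.1 _ (by simp)
      · have e : (Y ∪ {a | a ∈ xs.drop j}) ∩ {a, b, c} = {a, b} := by
          ext x
          constructor
          · rintro ⟨h, (rfl | rfl | rfl)⟩
            · simp
            · simp
            · exact absurd h hc
          · rintro (rfl | rfl)
            · exact ⟨ha, by simp⟩
            · exact ⟨hb, by simp⟩
        exact ⟨_, Or.inr ⟨j, hj, rfl⟩, e.symm, by rw [e]; simp⟩
  have hYS : Y ∈ S := by simpa using hYj xs.length le_rfl
  obtain ⟨h1, h2, h3, h4⟩ := hS
  ext C
  constructor
  · rintro ((⟨C, hC, rfl, hn⟩ | ⟨x, hx', rfl⟩) | ⟨j, hj, rfl⟩)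
    · rcases h4 C hC Y hYS with e | e | e
      · simp [e] at hn
      · rwa [e]
      · rwa [e]
    · exact h3 x ((hx x).1 hx').1
    · exact hYj j hj
  · intro hC
    by_cases hCY : C ⊆ Y
    · have e : C ∩ Y = C := Set.inter_eq_left.2 hCY
      exact Or.inl (Or.inl ⟨C, hC, e.symm, by rw [e]; exact (h1 C hC).2⟩)
    have hex : ∃ j, ∃ h : j < xs.length, xs[j] ∈ C := by
      obtain ⟨c, hc, hcY⟩ := Set.not_subset.1 hCY
      obtain ⟨j, hj, e⟩ := List.getElem_of_mem ((hx c).2 ⟨(h1 C hC).1 hc, hcY⟩)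
      exact ⟨j, hj, e ▸ hc⟩
    classical
    obtain ⟨hj, hjC⟩ := Nat.find_spec hex
    have hmin : ∀ i (hi : i < xs.length), xs[i] ∈ C → Nat.find hex ≤ i :=
      fun i hi h => Nat.find_min' hex ⟨hi, h⟩
    generalize Nat.find hex = j at hj hjC hmin
    have hd : xs.drop j = xs[j] :: xs.drop (j + 1) := List.drop_eq_getElem_cons hj
    have hCs : C ⊆ Y ∪ {a | a ∈ xs.drop j} := by
      intro c hc
      by_cases hcY : c ∈ Y
      · exact Or.inl hcY
      obtain ⟨i, hi, e⟩ := List.getElem_of_mem ((hx c).2 ⟨(h1 C hC).1 hc, hcY⟩)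
      have := hmin i hi (e ▸ hc)
      right
      refine List.mem_iff_getElem.2 ⟨i - j, by simp; omega, ?_⟩
      simp [Nat.add_sub_cancel' this, e]
    have hxjY : xs[j] ∉ Y := ((hx _).1 (List.getElem_mem hj)).2
    rcases h4 C hC _ (hYj (j + 1) hj) with e | e | e
    · left; right
      refine ⟨xs[j], List.getElem_mem hj, ?_⟩
      refine Set.Subset.antisymm ?_ (by simpa using hjC)
      intro c hc
      have hno : c ∉ Y ∪ {a | a ∈ xs.drop (j + 1)} := fun h => by
        have : c ∈ C ∩ (Y ∪ {a | a ∈ xs.drop (j + 1)}) := ⟨hc, h⟩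
        rw [e] at this; exact this
      rcases hCs hc with h | h
      · exact absurd (Or.inl h) hno
      · rw [Set.mem_ofPred_eq, hd, List.mem_cons] at h
        rcases h with h | h
        · exact h
        · exact absurd (Or.inr h) hno
    · exfalso
      rcases Set.inter_eq_left.1 e hjC with h | h
      · exact hxjY h
      · have := hnodup.sublist (List.drop_sublist j xs)
        rw [hd, List.nodup_cons] at this
        exact this.1 h
    · right
      refine ⟨j, hj.le, Set.Subset.antisymm hCs ?_⟩
      have hs := Set.inter_eq_right.1 e
      rintro c (h | h)
      · exact hs (Or.inl h)
      · rw [Set.mem_ofPred_eq, hd, List.mem_cons] at h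
        rcases h with h | h
        · exact h ▸ hjC
        · exact hs (Or.inr h)

theorem aux_neutral {X Y : Set α} (hYX : Y ⊆ X) {xs : List α}
    (hxs : {a | a ∈ xs} = X \ Y) {σ : α → α} (hσ : Set.BijOn σ Y Y) :
    ∃ τ : α → α, Set.BijOn τ X X ∧
      (∀ T ∈ RP Y, extendTree Y xs (mapTree σ T) = mapTree τ (extendTree Y xs T)) ∧
      (∀ S ∈ RP X, restrictTree Y (mapTree τ S) = mapTree σ (restrictTree Y S)) := by
  classical
  have hx : ∀ a, a ∈ xs ↔ a ∈ X ∧ a ∉ Y := fun a => by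
    have := Set.ext_iff.1 hxs a; simpa using this
  let τ : α → α := fun x => if x ∈ Y then σ x else x
  have t1 : ∀ x ∈ Y, τ x = σ x := fun x hx => if_pos hx
  have t2 : ∀ x, x ∉ Y → τ x = x := fun x hx => if_neg hx
  have t3 : ∀ x, τ x ∈ Y ↔ x ∈ Y := by
    intro x
    by_cases h : x ∈ Y
    · rw [t1 x h]; exact ⟨fun _ => h, fun _ => hσ.mapsTo h⟩
    · rw [t2 x h]
  have i1 : ∀ A ⊆ Y, τ '' A = σ '' A := fun A hA => Set.image_congr (fun a ha => t1 a (hA ha))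
  have i2 : ∀ A : Set α, (∀ a ∈ A, a ∉ Y) → τ '' A = A := fun A hA => by
    rw [Set.image_congr (fun a ha => t2 a (hA a ha))]; simp
  have hdrop : ∀ j, τ '' (Y ∪ {a | a ∈ xs.drop j}) = Y ∪ {a | a ∈ xs.drop j} := by
    intro j
    rw [Set.image_union, i1 Y subset_rfl, hσ.image_eq,
      i2 {a | a ∈ xs.drop j} (fun a ha => ((hx a).1 (List.mem_of_mem_drop ha)).2)]
  refine ⟨τ, ⟨?_, ?_, ?_⟩, ?_, ?_⟩
  · intro x hxX
    by_cases h : x ∈ Y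
    · exact hYX ((t3 x).2 h)
    · rwa [t2 x h]
  · intro x _ y _ e
    by_cases h : x ∈ Y
    · have h' : y ∈ Y := by rwa [← t3, ← e, t3]
      rw [t1 x h, t1 y h'] at e
      exact hσ.injOn h h' e
    · have h' : y ∉ Y := by rwa [← t3, ← e, t3]
      rwa [t2 x h, t2 y h'] at e
  · intro x hxX
    by_cases h : x ∈ Y
    · obtain ⟨y, hy, e⟩ := hσ.surjOn h
      exact ⟨y, hYX hy, by rw [t1 y hy, e]⟩
    · exact ⟨x, hxX, t2 x h⟩
  · intro T hT
    ext C
    constructor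
    · rintro ((⟨A, hA, rfl⟩ | ⟨x, hx', rfl⟩) | ⟨j, hj, rfl⟩)
      · exact ⟨A, Or.inl (Or.inl hA), i1 A (hT.1 A hA).1⟩
      · exact ⟨{x}, Or.inl (Or.inr ⟨x, hx', rfl⟩), by
          rw [Set.image_singleton, t2 x ((hx x).1 hx').2]⟩
      · exact ⟨_, Or.inr ⟨j, hj, rfl⟩, hdrop j⟩
    · rintro ⟨_, ((hA | ⟨x, hx', rfl⟩) | ⟨j, hj, rfl⟩), rfl⟩
      · exact Or.inl (Or.inl ⟨_, hA, (i1 _ (hT.1 _ hA).1).symm⟩)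
      · exact Or.inl (Or.inr ⟨x, hx', by rw [Set.image_singleton, t2 x ((hx x).1 hx').2]⟩)
      · exact Or.inr ⟨j, hj, hdrop j⟩
  · intro S hS
    have key : ∀ C : Set α, τ '' C ∩ Y = σ '' (C ∩ Y) := by
      intro C
      rw [← i1 _ Set.inter_subset_right]
      ext y
      constructor
      · rintro ⟨⟨x, hx, rfl⟩, hy⟩
        exact ⟨x, ⟨hx, (t3 x).1 hy⟩, rfl⟩
      · rintro ⟨x, ⟨hx, hy⟩, rfl⟩
        exact ⟨⟨x, hx, rfl⟩, (t3 x).2 hy⟩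
    ext D
    constructor
    · rintro ⟨_, ⟨C, hC, rfl⟩, rfl, hn⟩
      rw [key] at hn ⊢
      exact ⟨C ∩ Y, ⟨C, hC, rfl, hn.of_image⟩, rfl⟩
    · rintro ⟨_, ⟨C, hC, rfl, hn⟩, rfl⟩
      exact ⟨τ '' C, ⟨C, hC, rfl⟩, (key C).symm, by rw [key]; exact hn.image _⟩

/-- Let `Y` be a nonempty subset of a finite set `X`, with `X ∖ Y`
enumerated by the duplicate-free list `xs`. If the family `φ k : RP(X)^k → RP(X)`
(`k ≥ 1`) is regular, associatively stable and Pareto on rooted triples, then so is the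
induced family `ψ k (T₁, …, T_k) := φ k (T₁^X, …, T_k^X)|_Y` on `Y`. -/
theorem inducedMethod_regular_assocStable_pareto
    (X Y : Set α) (hXfin : X.Finite) (hY : Y.Nonempty) (hYX : Y ⊆ X)
    (xs : List α) (hnodup : xs.Nodup) (hxs : {a | a ∈ xs} = X \ Y)
    (φ : (k : ℕ) → (Fin k → Set (Set α)) → Set (Set α))
    (hφ : IsRegularAssocStablePareto X φ) :
    IsRegularAssocStablePareto Y (inducedMethod Y xs φ) := by
  have hφ' := hφ
  obtain ⟨p1, p2, p3, p4, p5, p6⟩ := hφ'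
  have hE : ∀ {k : ℕ} {Ts : Fin k → Set (Set α)}, (∀ i, Ts i ∈ RP Y) →
      ∀ i, extendTree Y xs (Ts i) ∈ RP X := fun h i => aux_extend hYX hY hxs (h i)
  refine ⟨?_, ?_, ?_, ?_, ?_, ?_⟩
  · intro k hk Ts hTs
    exact aux_restrict hY hYX (p1 k hk _ (hE hTs))
  · intro k hk T hT
    show restrictTree Y (φ k (fun _ => extendTree Y xs T)) = T
    rw [p2 k hk _ (aux_extend hYX hY hxs hT), aux_restrict_extend hxs hT]
  · intro k hk Ts hTs π
    show restrictTree Y (φ k ((fun i => extendTree Y xs (Ts i)) ∘ π)) = _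
    rw [p3 k hk _ (hE hTs) π]; rfl
  · intro k hk σ hσ Ts hTs
    obtain ⟨τ, b, e1, e2⟩ := aux_neutral hYX hxs hσ
    show restrictTree Y (φ k (fun i => extendTree Y xs (mapTree σ (Ts i)))) =
      mapTree σ (restrictTree Y (φ k (fun i => extendTree Y xs (Ts i))))
    rw [← e2 _ (p1 k hk _ (hE hTs)), ← p4 k hk τ b _ (hE hTs)]
    simp only [e1 _ (hTs _)]
  · intro k Ts hTs
    have hm := aux_main hXfin hY hYX hnodup hxs hφ (Nat.le_add_left 1 k)
      (Ts := Fin.init Ts) (fun i => hTs _)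
    show restrictTree Y (φ (k + 2) (fun i => extendTree Y xs (Ts i))) =
      restrictTree Y (φ 2 (fun i => extendTree Y xs
        ((![restrictTree Y (φ (k + 1) (fun i => extendTree Y xs (Fin.init Ts i))),
          Ts (Fin.last (k + 1))] : Fin 2 → Set (Set α)) i)))
    rw [p5 k _ (hE hTs)]
    congr 2
    funext i
    fin_cases i
    · exact hm.symm
    · rfl
  · intro k hk W hW hc T' hT' Ts hTs h
    show T' ⊆ restrictTree W (restrictTree Y (φ k (fun i => extendTree Y xs (Ts i))))
    rw [aux_restrict_restrict hW]
    refine p6 k hk W (hW.trans hYX) hc T' hT' _ (hE hTs) (fun i => (h i).trans ?_)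
    rintro D ⟨C, hC, e⟩
    exact ⟨C, Or.inl (Or.inl hC), e⟩
end

section
/- Let X be a finite set and let (φ_X^k)_{k ≥ 1}, φ_X^k : RP(X)^k → RP(X), be a family of consensus functions satisfying unanimity, anonymity, and associative stability. Then the binary operation φ_X^2 on RP(X) is commutative, idempotent, and associative. -/
open Set

variable {α : Type*}

/-- If a family of consensus functions `φ k : RP(X)^k → RP(X)` (`k ≥ 1`)
on a finite set `X` satisfies unanimity, anonymity, and associative stability, then the
binary operation `φ 2` on `RP(X)` is commutative, idempotent, and associative. -/
theorem binary_op_of_unanimous_anonymous_assocStable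
    (X : Set α) (hXfin : X.Finite)
    (φ : (k : ℕ) → (Fin k → Set (Set α)) → Set (Set α))
    -- each `φ k` maps profiles of trees on `X` to trees on `X`
    (hmaps : ∀ k, 1 ≤ k → ∀ Ts : Fin k → Set (Set α),
      (∀ i, Ts i ∈ RP X) → φ k Ts ∈ RP X)
    -- unanimity
    (huna : ∀ k, 1 ≤ k → ∀ T ∈ RP X, φ k (fun _ => T) = T)
    -- anonymity
    (hanon : ∀ k, 1 ≤ k → ∀ Ts : Fin k → Set (Set α), (∀ i, Ts i ∈ RP X) →
      ∀ π : Equiv.Perm (Fin k), φ k (Ts ∘ π) = φ k Ts)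
    -- associative stability
    (hassoc : ∀ k : ℕ, ∀ Ts : Fin (k + 2) → Set (Set α), (∀ i, Ts i ∈ RP X) →
      φ (k + 2) Ts = φ 2 ![φ (k + 1) (Fin.init Ts), Ts (Fin.last (k + 1))]) :
    -- commutative
    (∀ T₁ ∈ RP X, ∀ T₂ ∈ RP X, φ 2 ![T₁, T₂] = φ 2 ![T₂, T₁]) ∧
    -- idempotent
    (∀ T ∈ RP X, φ 2 ![T, T] = T) ∧
    -- associative
    (∀ T₁ ∈ RP X, ∀ T₂ ∈ RP X, ∀ T₃ ∈ RP X,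
      φ 2 ![φ 2 ![T₁, T₂], T₃] = φ 2 ![T₁, φ 2 ![T₂, T₃]]) := by
  have hcomm : ∀ T₁ ∈ RP X, ∀ T₂ ∈ RP X, φ 2 ![T₁, T₂] = φ 2 ![T₂, T₁] := by
    intro A hA B hB
    have h := hanon 2 (by norm_num) ![B, A]
      (by intro i; fin_cases i <;> simpa) (Equiv.swap 0 1)
    rw [← h]
    congr 1
    funext i
    fin_cases i <;> simp
  have h3 : ∀ A ∈ RP X, ∀ B ∈ RP X, ∀ C ∈ RP X,
      φ 3 ![A, B, C] = φ 2 ![φ 2 ![A, B], C] := by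
    intro A hA B hB C hC
    have h := hassoc 1 ![A, B, C] (by intro i; fin_cases i <;> simpa)
    have e : (Fin.init ![A, B, C] : Fin 2 → Set (Set α)) = ![A, B] := by
      funext i
      fin_cases i <;> rfl
    have h' : φ 3 ![A, B, C] = φ 2 ![φ 2 (Fin.init ![A, B, C]), C] := h
    rw [h', e]
  refine ⟨hcomm, ?_, ?_⟩
  · intro T hT
    have h := huna 2 (by norm_num) T hT
    have e : (![T, T] : Fin 2 → Set (Set α)) = fun _ => T := by
      funext i
      fin_cases i <;> rfl
    rw [e, h]
  · intro A hA B hB C hC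
    have hBC : φ 2 ![B, C] ∈ RP X :=
      hmaps 2 (by norm_num) _ (by intro i; fin_cases i <;> simpa)
    rw [hcomm A hA _ hBC, ← h3 A hA B hB C hC, ← h3 B hB C hC A hA]
    have h := hanon 3 (by norm_num) ![A, B, C]
      (by intro i; fin_cases i <;> simpa) (finRotate 3)
    rw [← h]
    congr 1
    funext i
    fin_cases i <;> rfl
end

section
/- A rooted phylogenetic tree is fully determined by its set of rooted triples: if T₁, T₂ ∈ RP(X) are such that for every 3-element subset Y ⊆ X, T₁|_Y is binary if and only if T₂|_Y is binary, and in that case T₁|_Y = T₂|_Y, then T₁ = T₂. -/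
open Set

variable {α : Type*}

lemma aux_binary {X : Set α} {T : Set (Set α)} (hT : T ∈ RP X) {a b c : α}
    (ha : a ∈ X) (hb : b ∈ X) (hc : c ∈ X)
    {C : Set α} (hC : C ∈ T) (haC : a ∈ C) (hbC : b ∈ C) (hcC : c ∉ C) :
    ({a, b} : Set α) ∈ restrictTree {a, b, c} T ∧
      IsBinary {a, b, c} (restrictTree {a, b, c} T) := by
  obtain ⟨h1, h2, h3, h4⟩ := hT
  have hab : ({a, b} : Set α) ∈ restrictTree {a, b, c} T := by
    refine ⟨C, hC, ?_, a, haC, by simp⟩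
    ext x
    simp only [mem_insert_iff, mem_singleton_iff, mem_inter_iff]
    grind
  have hY : ({a, b, c} : Set α) ∈ restrictTree {a, b, c} T := by
    refine ⟨X, h2, ?_, a, ha, by simp⟩
    ext x
    simp only [mem_insert_iff, mem_singleton_iff, mem_inter_iff]
    grind
  have hs : ∀ x ∈ ({a, b, c} : Set α), ({x} : Set α) ∈ restrictTree {a, b, c} T := by
    intro x hx
    have hxX : x ∈ X := by
      simp only [mem_insert_iff, mem_singleton_iff] at hx
      grind
    refine ⟨{x}, h3 x hxX, ?_, x, rfl, hx⟩
    ext y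
    simp only [mem_singleton_iff, mem_inter_iff]
    grind
  refine ⟨hab, ⟨?_, hY, hs, ?_⟩, ?_⟩
  · rintro D ⟨E, hE, rfl, hne⟩
    exact ⟨inter_subset_right, hne⟩
  · rintro D ⟨E, hE, rfl, -⟩ D' ⟨E', hE', rfl, -⟩
    rw [← inter_inter_distrib_right]
    rcases h4 E hE E' hE' with h | h | h <;> rw [h] <;> simp
  · rintro T' ⟨k1, k2, k3, k4⟩ hsub
    refine Subset.antisymm ?_ hsub
    intro D hD
    obtain ⟨hDY, hne⟩ := k1 D hD
    have hca : c ≠ a := by grind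
    have hcb : c ≠ b := by grind
    have hDY' : ∀ x ∈ D, x = a ∨ x = b ∨ x = c := fun x hx => by simpa using hDY hx
    have key := k4 D hD {a, b} (hsub hab)
    by_cases hcD : c ∈ D
    · rcases key with h | h | h
      · have haD : a ∉ D := fun h' => by
          have : a ∈ D ∩ {a, b} := ⟨h', by simp⟩
          rw [h] at this; exact this
        have hbD : b ∉ D := fun h' => by
          have : b ∈ D ∩ {a, b} := ⟨h', by simp⟩
          rw [h] at this; exact this
        have : D = {c} := by
          ext x; simp only [mem_singleton_iff]; grind
        rw [this]; exact hs c (by simp)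
      · have : c ∈ D ∩ {a, b} := by rw [h]; exact hcD
        simp [hca, hcb] at this
      · have haD : a ∈ D ∩ {a, b} := by rw [h]; simp
        have hbD : b ∈ D ∩ {a, b} := by rw [h]; simp
        have : D = {a, b, c} := by
          ext x; simp only [mem_insert_iff, mem_singleton_iff]
          have := haD.1
          have := hbD.1
          grind
        rw [this]; exact hY
    · by_cases haD : a ∈ D
      · by_cases hbD : b ∈ D
        · have : D = {a, b} := by
            ext x; simp only [mem_insert_iff, mem_singleton_iff]; grind
          rw [this]; exact hab
        · have : D = {a} := by
            ext x; simp only [mem_singleton_iff]; grind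
          rw [this]; exact hs a (by simp)
      · obtain ⟨y, hy⟩ := hne
        have : D = {b} := by
          ext x; simp only [mem_singleton_iff]; grind
        rw [this]; exact hs b (by simp)

lemma aux_comparable {X : Set α} {T : Set (Set α)} (hT : T ∈ RP X) {A B : Set α}
    (hA : A ∈ T) (hB : B ∈ T) {a : α} (haA : a ∈ A) (haB : a ∈ B) : A ⊆ B ∨ B ⊆ A := by
  rcases hT.2.2.2 A hA B hB with h | h | h
  · have : a ∈ A ∩ B := ⟨haA, haB⟩
    rw [h] at this; exact this.elim
  · exact Or.inl (inter_eq_left.1 h)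
  · exact Or.inr (inter_eq_right.1 h)

lemma aux_subset (X : Set α) (hXfin : X.Finite)
    (T₁ T₂ : Set (Set α)) (h₁ : T₁ ∈ RP X) (h₂ : T₂ ∈ RP X)
    (h : ∀ Y : Set α, Y ⊆ X → Y.ncard = 3 →
      (IsBinary Y (restrictTree Y T₁) → restrictTree Y T₁ = restrictTree Y T₂)) :
    T₁ ⊆ T₂ := by
  intro C hC
  obtain ⟨hCX, a, haC⟩ := h₁.1 C hC
  have fin : T₂.Finite := hXfin.finite_subsets.subset fun D hD => (h₂.1 D hD).1
  have triple : ∀ b ∈ C, ∀ c ∈ X, c ∉ C → ∃ E ∈ T₂, a ∈ E ∧ b ∈ E ∧ c ∉ E := by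
    intro b hb c hc hcC
    by_cases hab : a = b
    · subst hab
      exact ⟨{a}, h₂.2.2.1 a (hCX haC), rfl, rfl, by rintro rfl; exact hcC haC⟩
    have hca : a ≠ c := by grind
    have hcb : b ≠ c := by grind
    obtain ⟨p, q⟩ := aux_binary h₁ (hCX haC) (hCX hb) hc hC haC hb hcC
    have hY : ({a, b, c} : Set α) ⊆ X := by
      rintro x (rfl | rfl | rfl)
      exacts [hCX haC, hCX hb, hc]
    rw [h _ hY (ncard_eq_three.2 ⟨a, b, c, hab, hca, hcb, rfl⟩) q] at p
    obtain ⟨E, hE, he, -⟩ := p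
    have e1 : a ∈ E ∩ {a, b, c} := by rw [← he]; simp
    have e2 : b ∈ E ∩ {a, b, c} := by rw [← he]; simp
    refine ⟨E, hE, e1.1, e2.1, fun hcE => ?_⟩
    have e3 : c ∈ E ∩ {a, b, c} := ⟨hcE, by simp⟩
    rw [← he] at e3
    simp [hca.symm, hcb.symm] at e3
  have sep : ∀ c ∈ X, c ∉ C → ∃ E ∈ T₂, C ⊆ E ∧ c ∉ E := by
    intro c hc hcC
    obtain ⟨E, hE⟩ := (fin.subset (sep_subset T₂ fun E => a ∈ E ∧ c ∉ E)).exists_maximal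
      (by obtain ⟨E, hE, h1, -, h2⟩ := triple a haC c hc hcC; exact ⟨E, hE, h1, h2⟩)
    refine ⟨E, hE.1.1, fun b hb => ?_, hE.1.2.2⟩
    obtain ⟨F, hF, f1, f2, f3⟩ := triple b hb c hc hcC
    rcases aux_comparable h₂ hF hE.1.1 f1 hE.1.2.1 with k | k
    · exact k f2
    · exact hE.2 ⟨hF, f1, f3⟩ k f2
  obtain ⟨D, hD⟩ := (fin.subset (sep_subset T₂ fun E => C ⊆ E)).exists_minimal
    ⟨X, h₂.2.1, hCX⟩
  have : C = D := by
    refine Subset.antisymm hD.1.2 fun c hcD => ?_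
    by_contra hcC
    obtain ⟨E, hE, e1, e2⟩ := sep c ((h₂.1 D hD.1.1).1 hcD) hcC
    rcases aux_comparable h₂ hE hD.1.1 (e1 haC) (hD.1.2 haC) with k | k
    · exact e2 (hD.2 ⟨hE, e1⟩ k hcD)
    · exact e2 (k hcD)
  rw [this]; exact hD.1.1

/-- A rooted phylogenetic tree is fully determined by its set of rooted
triples: if `T₁, T₂ ∈ RP(X)` are such that for every 3-element subset `Y ⊆ X` the
restriction `T₁|_Y` is binary iff `T₂|_Y` is binary, and in that case `T₁|_Y = T₂|_Y`,
then `T₁ = T₂`. -/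
theorem tree_determined_by_rooted_triples
    (X : Set α) (hXfin : X.Finite)
    (T₁ T₂ : Set (Set α)) (h₁ : T₁ ∈ RP X) (h₂ : T₂ ∈ RP X)
    (h : ∀ Y : Set α, Y ⊆ X → Y.ncard = 3 →
      (IsBinary Y (restrictTree Y T₁) ↔ IsBinary Y (restrictTree Y T₂)) ∧
      (IsBinary Y (restrictTree Y T₁) → restrictTree Y T₁ = restrictTree Y T₂)) :
    T₁ = T₂ := by
  refine Subset.antisymm
    (aux_subset X hXfin T₁ T₂ h₁ h₂ fun Y hY hc => (h Y hY hc).2)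
    (aux_subset X hXfin T₂ T₁ h₂ h₁ fun Y hY hc hb => ?_)
  exact ((h Y hY hc).2 ((h Y hY hc).1.2 hb)).symm
end
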